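/- arXiv:1310.2447 — 3 statements merged into one kernel-verified Lean document; each statement's English description precedes it below -/
import Mathlib

section
/- Let F ∈ ℝ[X,Y] be a nonzero bivariate polynomial of total degree d ≥ 1 that is irreducible in ℂ[X,Y], and let G ∈ ℝ[X,Y] be a bivariate t-sparse polynomial (t ≥ 1). Then there is an absolute constant C > 0 (independent of d, t, F, G) such that the set of real solutions {(x,y) ∈ ℝ² : F(x,y) = 0 and G(x,y) = 0} has at most C·(d³·t + d²·t³) connected components. -/
open MvPolynomial

lemma finrank_restrictTotalDegree_two (n : ℕ) :
    2 * Module.finrank ℝ (restrictTotalDegree (Fin 2) ℝ n) = (n + 1) * (n + 2) := by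
  have h1 : Module.finrank ℝ (restrictTotalDegree (Fin 2) ℝ n) =
      Nat.card {s : Fin 2 →₀ ℕ | s.degree ≤ n} :=
    Module.finrank_eq_nat_card_basis (basisRestrictSupport ℝ _)
  have e : {s : Fin 2 →₀ ℕ | s.degree ≤ n} ≃
      ((Finset.range (n + 1)).sigma fun i => Finset.range (n + 1 - i)) :=
    { toFun := fun s => ⟨⟨s.1 0, s.1 1⟩, by
        have := s.2
        simp [Finsupp.degree_eq_sum, Fin.sum_univ_two] at this ⊢
        omega⟩
      invFun := fun p => ⟨Finsupp.equivFunOnFinite.symm ![p.1.1, p.1.2], by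
        have := p.2
        rw [Finset.mem_sigma, Finset.mem_range, Finset.mem_range] at this
        simp only [Set.mem_ofPred_eq, Finsupp.degree_eq_sum, Fin.sum_univ_two,
          Finsupp.equivFunOnFinite_symm_apply_apply, Matrix.cons_val_zero, Matrix.cons_val_one]
        omega⟩
      left_inv := fun s => by
        ext i
        fin_cases i <;> rfl
      right_inv := fun p => by
        ext <;> rfl }
  rw [h1, Nat.card_congr e, Nat.card_eq_fintype_card, Fintype.card_coe, Finset.card_sigma]
  simp only [Finset.card_range]
  have h3 := Finset.sum_flip (n := n) (fun i => i + 1)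
  rw [Finset.sum_congr rfl fun i hi => show n + 1 - i = n - i + 1 by
    rw [Finset.mem_range] at hi
    omega, h3]
  have h2 := Finset.sum_range_id_mul_two (n + 2)
  rw [Finset.sum_range_succ'] at h2
  simp only [add_zero] at h2
  rw [mul_comm, h2, mul_comm]
  rfl

lemma exists_eval_eq_ite (Z : Finset (ℝ × ℝ)) (p : ℝ × ℝ) (hp : p ∈ Z) :
    ∃ P : MvPolynomial (Fin 2) ℝ, P.totalDegree ≤ Z.card ∧
      ∀ q ∈ Z, eval ![q.1, q.2] P = if q = p then 1 else 0 := by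
  classical
  have h : ∀ q : ℝ × ℝ, ∃ l : MvPolynomial (Fin 2) ℝ, l.totalDegree ≤ 1 ∧
      eval ![q.1, q.2] l = 0 ∧ (q ≠ p → eval ![p.1, p.2] l = 1) := by
    intro q
    by_cases h1 : q.1 = p.1
    · by_cases h2 : q.2 = p.2
      · exact ⟨0, by simp, by simp, fun h => absurd (Prod.ext h1 h2) h⟩
      · refine ⟨C (p.2 - q.2)⁻¹ * (X 1 - C q.2), ?_, by simp, fun _ => ?_⟩
        · refine (totalDegree_mul _ _).trans ?_
          rw [totalDegree_C, zero_add]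
          exact (totalDegree_sub_C_le _ _).trans (by simp)
        · have : p.2 - q.2 ≠ 0 := sub_ne_zero.2 (Ne.symm h2)
          simp [this]
    · refine ⟨C (p.1 - q.1)⁻¹ * (X 0 - C q.1), ?_, by simp, fun _ => ?_⟩
      · refine (totalDegree_mul _ _).trans ?_
        rw [totalDegree_C, zero_add]
        exact (totalDegree_sub_C_le _ _).trans (by simp)
      · have : p.1 - q.1 ≠ 0 := sub_ne_zero.2 (Ne.symm h1)
        simp [this]
  choose l hl1 hl2 hl3 using h
  refine ⟨∏ q ∈ Z.erase p, l q, ?_, ?_⟩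
  · refine (totalDegree_finsetProd _ _).trans ((Finset.sum_le_card_nsmul _ _ 1
      fun q _ => hl1 q).trans ?_)
    simpa using Finset.card_le_card (Finset.erase_subset p Z)
  · intro q hq
    rw [map_prod]
    split_ifs with h
    · subst h
      exact Finset.prod_eq_one fun r hr => hl3 r (Finset.ne_of_mem_erase hr)
    · exact Finset.prod_eq_zero (Finset.mem_erase.2 ⟨h, hq⟩) (hl2 q)

/-- The weak form of Bézout's theorem: the number of common real zeros of `F` and `H` is at most
the product of the degrees. -/
theorem card_common_zeros_le {F H : MvPolynomial (Fin 2) ℝ} (hF : Irreducible F) (hFH : ¬ F ∣ H)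
    (Z : Finset (ℝ × ℝ))
    (hZ : ∀ p ∈ Z, eval ![p.1, p.2] F = 0 ∧ eval ![p.1, p.2] H = 0) :
    Z.card ≤ F.totalDegree * H.totalDegree := by
  classical
  have hH0 : H ≠ 0 := fun h => hFH (h ▸ dvd_zero F)
  have hF0 := hF.ne_zero
  set d := F.totalDegree with hd
  set m := H.totalDegree with hm
  obtain ⟨r, hr⟩ : ∃ r, r = Z.card := ⟨_, rfl⟩
  let V (n : ℕ) := restrictTotalDegree (Fin 2) ℝ n
  let ev : V (r + d + m) →ₗ[ℝ] (Z → ℝ) :=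
    (LinearMap.pi fun p : Z => (MvPolynomial.aeval ![p.1.1, p.1.2] :
      MvPolynomial (Fin 2) ℝ →ₐ[ℝ] ℝ).toLinearMap) ∘ₗ (V (r + d + m)).subtype
  have hev : ∀ (P : V (r + d + m)) (p : Z), ev P p = eval ![p.1.1, p.1.2] P.1 := by
    intro P p
    simp [ev, MvPolynomial.aeval_eq_eval]
  have hsurj : Function.Surjective ev := by
    choose! P hP1 hP2 using exists_eval_eq_ite Z
    intro f
    refine ⟨∑ p : Z, f p • ⟨P p.1, (mem_restrictTotalDegree _ _ _).2
      ((hP1 p.1 p.2).trans (by omega))⟩, ?_⟩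
    ext q
    rw [map_sum, Finset.sum_apply, Finset.sum_eq_single q]
    · rw [map_smul, Pi.smul_apply, hev, hP2 q.1 q.2 q.1 q.2]
      simp
    · intro p _ hpq
      rw [map_smul, Pi.smul_apply, hev, hP2 p.1 p.2 q.1 q.2, if_neg]
      · simp
      · exact fun h => hpq (Subtype.ext h.symm)
    · simp
  let L : (V (r + m) × V (r + d)) →ₗ[ℝ] V (r + d + m) :=
    LinearMap.codRestrict _ (LinearMap.coprod
      ((LinearMap.mulLeft ℝ F) ∘ₗ (V (r + m)).subtype)
      ((LinearMap.mulLeft ℝ H) ∘ₗ (V (r + d)).subtype)) (by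
        rintro ⟨⟨A, hA⟩, ⟨B, hB⟩⟩
        rw [mem_restrictTotalDegree] at hA hB ⊢
        simp only [LinearMap.coprod_apply, LinearMap.comp_apply, Submodule.subtype_apply,
          LinearMap.mulLeft_apply]
        refine (totalDegree_add _ _).trans (max_le ?_ ?_)
        · exact (totalDegree_mul _ _).trans (by omega)
        · exact (totalDegree_mul _ _).trans (by omega))
  have hL : ∀ A B, (L (A, B)).1 = F * A.1 + H * B.1 := fun A B => rfl
  have hrange : LinearMap.range L ≤ LinearMap.ker ev := by
    rintro _ ⟨⟨A, B⟩, rfl⟩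
    rw [LinearMap.mem_ker]
    ext p
    rw [hev, hL]
    simp [hZ p.1 p.2]
  let K : V r →ₗ[ℝ] (V (r + m) × V (r + d)) :=
    LinearMap.prod
      (LinearMap.codRestrict _ ((LinearMap.mulLeft ℝ (-H)) ∘ₗ (V r).subtype) (by
        rintro ⟨A, hA⟩
        rw [mem_restrictTotalDegree] at hA ⊢
        refine (totalDegree_mul _ _).trans ?_
        rw [totalDegree_neg]
        simp only [Submodule.subtype_apply]
        omega))
      (LinearMap.codRestrict _ ((LinearMap.mulLeft ℝ F) ∘ₗ (V r).subtype) (by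
        rintro ⟨A, hA⟩
        rw [mem_restrictTotalDegree] at hA ⊢
        refine (totalDegree_mul _ _).trans ?_
        simp only [Submodule.subtype_apply]
        omega))
  have hker : LinearMap.ker L ≤ LinearMap.range K := by
    rintro ⟨A, B⟩ hAB
    rw [LinearMap.mem_ker] at hAB
    have h0 : F * A.1 + H * B.1 = 0 := by rw [← hL, hAB]; rfl
    have hdvd : F ∣ H * B.1 := ⟨-A.1, by linear_combination h0⟩
    obtain ⟨Q, hQ⟩ := (hF.prime.dvd_or_dvd hdvd).resolve_left hFH
    have hQr : Q.totalDegree ≤ r := by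
      by_cases hQ0 : Q = 0
      · simp [hQ0]
      · have h1 := B.2
        rw [mem_restrictTotalDegree, hQ, totalDegree_mul_of_isDomain hF0 hQ0] at h1
        omega
    have hA : A.1 = -H * Q := by
      apply mul_left_cancel₀ hF0
      rw [hQ] at h0
      linear_combination h0
    refine ⟨⟨Q, (mem_restrictTotalDegree _ _ _).2 hQr⟩, ?_⟩
    ext1
    · exact Subtype.ext hA.symm
    · exact Subtype.ext hQ.symm
  have e1 := ev.finrank_range_add_finrank_ker
  have e2 := L.finrank_range_add_finrank_ker
  rw [LinearMap.range_eq_top.2 hsurj, finrank_top, Module.finrank_fintype_fun_eq_card,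
    Fintype.card_coe] at e1
  have e3 := Submodule.finrank_mono hrange
  have e4 := (Submodule.finrank_mono hker).trans K.finrank_range_le
  rw [Module.finrank_prod] at e2
  have f1 := finrank_restrictTotalDegree_two (r + d + m)
  have f2 := finrank_restrictTotalDegree_two (r + m)
  have f3 := finrank_restrictTotalDegree_two (r + d)
  have f4 := finrank_restrictTotalDegree_two r
  nlinarith

namespace Matrix

/-- The Desnanot–Jacobi identity (Sylvester's identity for a `2 × 2` bordering block). -/
theorem det_mul_det_fromBlocks_fin_two {R m : Type*} [CommRing R] [IsDomain R] [Fintype m]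
    [DecidableEq m] (A : Matrix m m R) (B : Matrix m (Fin 2) R) (C : Matrix (Fin 2) m R)
    (D : Matrix (Fin 2) (Fin 2) R) (hA : A.det ≠ 0) (b : Fin 2 → Fin 2 → R)
    (hb : ∀ r c, b r c = (fromBlocks A (B.submatrix id fun _ : Fin 1 => c)
      (C.submatrix (fun _ : Fin 1 => r) id) (D.submatrix (fun _ => r) fun _ => c)).det) :
    A.det * (fromBlocks A B C D).det = b 0 0 * b 1 1 - b 0 1 * b 1 0 := by
  let f := algebraMap R (FractionRing R)
  have hf : Function.Injective f := IsFractionRing.injective R (FractionRing R)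
  have hA' : (f.mapMatrix A).det ≠ 0 := by
    rw [← RingHom.map_det]
    exact fun h => hA (hf (by rw [h, map_zero]))
  have : Invertible (f.mapMatrix A) := invertibleOfIsUnitDet _ (isUnit_iff_ne_zero.2 hA')
  have hb' : ∀ r c, f (b r c) = (f.mapMatrix A).det *
      ((D.map f) r c - ((C.map f) * ⅟(f.mapMatrix A) * (B.map f)) r c) := by
    intro r c
    rw [hb, RingHom.map_det, RingHom.mapMatrix_apply, fromBlocks_map,
      ← RingHom.mapMatrix_apply f A, det_fromBlocks₁₁]
    congr 1
    rw [det_fin_one]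
    rfl
  apply hf
  rw [map_mul, RingHom.map_det, RingHom.map_det f (fromBlocks A B C D), RingHom.mapMatrix_apply f
    (fromBlocks A B C D), fromBlocks_map, ← RingHom.mapMatrix_apply f A, det_fromBlocks₁₁,
    map_sub, map_mul, map_mul, hb', hb', hb', hb', det_fin_two]
  simp only [sub_apply]
  ring

end Matrix

namespace Derivation

variable {R : Type*} [CommRing R] [Algebra ℝ R] (D : Derivation ℝ R R)

lemma apply_prod {ι : Type*} [DecidableEq ι] (s : Finset ι) (a : ι → R) :
    D (∏ j ∈ s, a j) = ∑ i ∈ s, ∏ j ∈ s, Function.update a i (D (a i)) j := by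
  induction s using Finset.induction_on with
  | empty => simp
  | insert k s hk ih =>
    rw [Finset.prod_insert hk, D.leibniz, ih, Finset.sum_insert hk, Finset.prod_insert hk,
      Function.update_self, smul_eq_mul, smul_eq_mul, add_comm, Finset.mul_sum]
    congr 1
    · rw [mul_comm]
      congr 1
      exact Finset.prod_congr rfl fun j hj =>
        (Function.update_of_ne (ne_of_mem_of_not_mem hj hk) _ _).symm
    · refine Finset.sum_congr rfl fun i hi => ?_
      rw [Finset.prod_insert hk, Function.update_of_ne (ne_of_mem_of_not_mem hi hk).symm]

lemma apply_det {n : Type*} [Fintype n] [DecidableEq n] (M : Matrix n n R) :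
    D M.det = ∑ i, (M.updateRow i fun j => D (M i j)).det := by
  have h (N : Matrix n n R) : N.det = ∑ σ : Equiv.Perm n, Equiv.Perm.sign σ • ∏ i, N i (σ i) := by
    rw [← Matrix.det_transpose, Matrix.det_apply]
    rfl
  simp_rw [h, map_sum]
  rw [Finset.sum_comm]
  refine Finset.sum_congr rfl fun σ _ => ?_
  rw [Units.smul_def, map_zsmul, apply_prod, Finset.smul_sum]
  refine Finset.sum_congr rfl fun i _ => ?_
  rw [Units.smul_def]
  congr 1
  refine Finset.prod_congr rfl fun j _ => ?_
  rcases eq_or_ne j i with rfl | h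
  · simp
  · simp [h]

/-- The Wronskian of `g 0, …, g (k - 1)` with respect to the derivation `D`. -/
noncomputable def wronskian (g : ℕ → R) (k : ℕ) : R :=
  (Matrix.of fun i j : Fin k => (D.toLinearMap ^ (i : ℕ)) (g j)).det

@[simp] lemma wronskian_zero (g : ℕ → R) : D.wronskian g 0 = 1 := by
  simp [wronskian]

lemma toLinearMap_pow_succ_apply (i : ℕ) (f : R) :
    (D.toLinearMap ^ (i + 1)) f = D ((D.toLinearMap ^ i) f) := by
  rw [pow_succ', Module.End.mul_apply]
  rfl

/-- Only the last row contributes to the derivative of a Wronskian. -/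
lemma apply_wronskian_succ (g : ℕ → R) (k : ℕ) :
    D (D.wronskian g (k + 1)) = (Matrix.of fun i j : Fin (k + 1) =>
      (D.toLinearMap ^ (if i = Fin.last k then k + 1 else (i : ℕ))) (g j)).det := by
  rw [wronskian, apply_det, Finset.sum_eq_single (Fin.last k)]
  · congr 1
    ext i j
    by_cases h : i = Fin.last k
    · subst h
      simp [toLinearMap_pow_succ_apply]
    · simp [h]
  · intro i _ hi
    have hlt : (i : ℕ) < k := Fin.val_lt_last hi
    refine Matrix.det_zero_of_row_eq (i := i) (j := ⟨i + 1, by omega⟩) (by simp [Fin.ext_iff]) ?_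
    ext j
    rw [Matrix.updateRow_self, Matrix.updateRow_ne (by simp [Fin.ext_iff])]
    simp [toLinearMap_pow_succ_apply]
  · simp

lemma wronskian_update_eq (g : ℕ → R) (k : ℕ) (f : R) :
    D.wronskian (Function.update g k f) (k + 1) =
      ((Matrix.of fun i j : Fin (k + 1) => (D.toLinearMap ^ (i : ℕ)) (g j)).updateCol (Fin.last k)
        fun i => (D.toLinearMap ^ (i : ℕ)) f).det := by
  unfold wronskian
  congr 1
  ext i j
  rcases eq_or_ne j (Fin.last k) with rfl | h
  · simp
  · have : (j : ℕ) ≠ k := fun h' => h (Fin.ext h')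
    simp [h, this]

lemma wronskian_update_sub_smul (g : ℕ → R) (k : ℕ) (f : R) (c : ℝ) :
    D.wronskian (Function.update g k (f - c • g k)) (k + 1) =
      D.wronskian (Function.update g k f) (k + 1) - c • D.wronskian g (k + 1) := by
  conv_rhs => rw [← Function.update_eq_self k g]
  rw [Function.update_idem, sub_eq_add_neg, wronskian_update_eq, wronskian_update_eq,
    wronskian_update_eq, sub_eq_add_neg, ← neg_smul c,
    ← neg_smul c, ← algebraMap_smul R (-c) (Matrix.det _), smul_eq_mul, ← Matrix.det_updateCol_smul,
    ← Matrix.det_updateCol_add]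
  congr 2
  ext i
  simp only [map_add, LinearMap.map_smul, Pi.add_apply, Pi.smul_apply, smul_eq_mul]
  rw [← Algebra.smul_def]

lemma wronskian_update_sum (g : ℕ → R) (k : ℕ) (c : ℕ → ℝ) :
    D.wronskian (Function.update g k (∑ j ∈ Finset.range (k + 1), c j • g j)) (k + 1) =
      c k • D.wronskian g (k + 1) := by
  rw [wronskian_update_eq, ← algebraMap_smul R (c k), wronskian]
  have := Matrix.det_updateCol_sum (Matrix.of fun i j : Fin (k + 1) =>
    (D.toLinearMap ^ (i : ℕ)) (g j)) (Fin.last k) (fun j => algebraMap ℝ R (c j))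
  rw [Fin.val_last] at this
  rw [← this]
  congr 2
  ext i
  rw [map_sum, Finset.sum_range]
  simp only [LinearMap.map_smul, Matrix.of_apply, algebraMap_smul]

theorem wronskian_mul_wronskian [IsDomain R] (g : ℕ → R) (k : ℕ) (hk : D.wronskian g k ≠ 0)
    (f : R) :
    D.wronskian g k * D.wronskian (Function.update g (k + 1) f) (k + 2) =
      D.wronskian g (k + 1) * D (D.wronskian (Function.update g k f) (k + 1)) -
      D.wronskian (Function.update g k f) (k + 1) * D (D.wronskian g (k + 1)) := by
  let c : Fin 2 → R := ![g k, f]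
  let A := Matrix.of fun i j : Fin k => (D.toLinearMap ^ (i : ℕ)) (g j)
  let B := Matrix.of fun (i : Fin k) (j : Fin 2) => (D.toLinearMap ^ (i : ℕ)) (c j)
  let C := Matrix.of fun (i : Fin 2) (j : Fin k) => (D.toLinearMap ^ (k + i : ℕ)) (g j)
  let D' := Matrix.of fun (i : Fin 2) (j : Fin 2) => (D.toLinearMap ^ (k + i : ℕ)) (c j)
  have key := Matrix.det_mul_det_fromBlocks_fin_two A B C D' hk _ fun _ _ => rfl
  have h2 : (Matrix.fromBlocks A B C D').det =
      D.wronskian (Function.update g (k + 1) f) (k + 2) := by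
    rw [wronskian, ← Matrix.det_submatrix_equiv_self finSumFinEquiv]
    congr 1
    ext i j
    rcases i with i | i <;> rcases j with j | j
    · have : (j : ℕ) ≠ k + 1 := by omega
      simp [A, this]
    · fin_cases j <;> simp [B, c]
    · have : (j : ℕ) ≠ k + 1 := by omega
      simp [C, this]
    · fin_cases j <;> simp [D', c]
  have h1 : ∀ (r s : Fin 2), (Matrix.fromBlocks A (B.submatrix id fun _ : Fin 1 => s)
      (C.submatrix (fun _ : Fin 1 => r) id) (D'.submatrix (fun _ => r) fun _ => s)).det =
      (Matrix.of fun i j : Fin (k + 1) =>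
        (D.toLinearMap ^ (if i = Fin.last k then k + r else (i : ℕ)))
          (Function.update g k (c s) j)).det := by
    intro r s
    rw [← Matrix.det_submatrix_equiv_self finSumFinEquiv]
    congr 1
    ext i j
    rcases i with i | i <;> rcases j with j | j
    · simp [A, j.2.ne, Fin.ext_iff, i.2.ne]
    · simp [B, Fin.ext_iff, i.2.ne]
    · have h1 : (j : ℕ) ≠ k := by omega
      simp [C, h1, Fin.ext_iff]
    · simp [D', Fin.ext_iff]
  have h0 : ∀ g : ℕ → R, (Matrix.of fun i j : Fin (k + 1) =>
        (D.toLinearMap ^ (if i = Fin.last k then k + ((0 : Fin 2) : ℕ) else (i : ℕ)))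
          (g j)).det = D.wronskian g (k + 1) := by
    intro g
    unfold wronskian
    congr 1
    ext i j
    by_cases h : i = Fin.last k <;> simp [h]
  rw [h2] at key
  simp only [h1, h0] at key
  simp only [Fin.val_one, ← apply_wronskian_succ] at key
  simp only [c, Matrix.cons_val_zero, Matrix.cons_val_one, Function.update_eq_self] at key
  exact key

end Derivation

lemma totalDegree_pderiv_le {σ R : Type*} [CommSemiring R] (i : σ) (P : MvPolynomial σ R) :
    (pderiv i P).totalDegree ≤ P.totalDegree - 1 := by
  classical
  rw [totalDegree, Finset.sup_le_iff]
  intro m hm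
  rw [mem_support_iff, coeff_pderiv] at hm
  have h := le_totalDegree (mem_support_iff.2 (left_ne_zero_of_mul hm))
  have h2 : ((m + Finsupp.single i 1).sum fun _ e => e) = (m.sum fun _ e => e) + 1 := by
    rw [Finsupp.sum_add_index' (by simp) (by simp), Finsupp.sum_single_index rfl]
  omega

lemma not_dvd_pderiv {σ R : Type*} [CommRing R] [IsDomain R] {F : MvPolynomial σ R} {i : σ}
    (h : pderiv i F ≠ 0) : ¬ F ∣ pderiv i F := by
  intro hd
  have h1 := totalDegree_le_of_dvd_of_isDomain hd h
  have h2 := totalDegree_pderiv_le i F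
  have h3 : F.totalDegree = 0 := by omega
  rw [totalDegree_eq_zero_iff_eq_C] at h3
  rw [h3, pderiv_C] at h
  exact h rfl

/-- The derivation `X Y (F_Y ∂_X - F_X ∂_Y)`, which is tangent to the curve `F = 0` and
logarithmic along the coordinate axes. -/
noncomputable def tangentDeriv (F : MvPolynomial (Fin 2) ℝ) :
    Derivation ℝ (MvPolynomial (Fin 2) ℝ) (MvPolynomial (Fin 2) ℝ) :=
  (X 0 * X 1 * pderiv 1 F) • pderiv 0 - (X 0 * X 1 * pderiv 0 F) • pderiv 1

lemma tangentDeriv_apply (F P : MvPolynomial (Fin 2) ℝ) :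
    tangentDeriv F P = X 0 * X 1 * (pderiv 1 F * pderiv 0 P - pderiv 0 F * pderiv 1 P) := by
  simp only [tangentDeriv, Derivation.sub_apply, Derivation.smul_apply, smul_eq_mul]
  ring

lemma totalDegree_X_mul_pderiv_mul_le (F P : MvPolynomial (Fin 2) ℝ) (hF : 1 ≤ F.totalDegree)
    (hP : 1 ≤ P.totalDegree) (i j k l : Fin 2) :
    (X i * X j * (pderiv k F * pderiv l P)).totalDegree ≤ P.totalDegree + F.totalDegree := by
  have h1 := totalDegree_mul (X i * X j) (pderiv k F * pderiv l P)
  have h2 := totalDegree_mul (X i : MvPolynomial (Fin 2) ℝ) (X j)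
  have h3 := totalDegree_mul (pderiv k F) (pderiv l P)
  have h4 := totalDegree_pderiv_le k F
  have h5 := totalDegree_pderiv_le l P
  rw [totalDegree_X, totalDegree_X] at h2
  omega

lemma totalDegree_tangentDeriv_le (F P : MvPolynomial (Fin 2) ℝ) (hF : 1 ≤ F.totalDegree) :
    (tangentDeriv F P).totalDegree ≤ P.totalDegree + F.totalDegree := by
  rcases Nat.eq_zero_or_pos P.totalDegree with h | h
  · rw [totalDegree_eq_zero_iff_eq_C] at h
    rw [tangentDeriv_apply, h]
    simp
  · rw [tangentDeriv_apply, mul_sub]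
    exact (totalDegree_sub _ _).trans (max_le (totalDegree_X_mul_pderiv_mul_le F P hF h _ _ _ _)
      (totalDegree_X_mul_pderiv_mul_le F P hF h _ _ _ _))

lemma exists_tangentDeriv_monomial (F : MvPolynomial (Fin 2) ℝ) (hF : 1 ≤ F.totalDegree)
    (e : Fin 2 →₀ ℕ) :
    ∃ L : MvPolynomial (Fin 2) ℝ, L.totalDegree ≤ F.totalDegree ∧
      tangentDeriv F (monomial e 1) = monomial e 1 * L := by
  refine ⟨C (e 0 : ℝ) * (X 1 * pderiv 1 F) - C (e 1 : ℝ) * (X 0 * pderiv 0 F), ?_, ?_⟩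
  · have h : ∀ (c : ℝ) (i j : Fin 2), (C c * (X i * pderiv j F)).totalDegree ≤ F.totalDegree := by
      intro c i j
      have h1 := totalDegree_mul (C c) (X i * pderiv j F)
      have h2 := totalDegree_mul (X i) (pderiv j F)
      have h3 := totalDegree_pderiv_le j F
      rw [totalDegree_C] at h1
      rw [totalDegree_X] at h2
      omega
    exact (totalDegree_sub _ _).trans (max_le (h _ _ _) (h _ _ _))
  · have h0 := X_mul_pderiv_monomial (i := (0 : Fin 2)) (m := e) (r := (1 : ℝ))
    have h1 := X_mul_pderiv_monomial (i := (1 : Fin 2)) (m := e) (r := (1 : ℝ))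
    rw [nsmul_eq_mul] at h0 h1
    rw [tangentDeriv_apply, map_natCast, map_natCast]
    linear_combination (X 1 * pderiv 1 F) * h0 - X 0 * pderiv 0 F * h1

lemma exists_tangentDeriv_pow_monomial (F : MvPolynomial (Fin 2) ℝ) (hF : 1 ≤ F.totalDegree)
    (e : Fin 2 →₀ ℕ) (i : ℕ) :
    ∃ Q : MvPolynomial (Fin 2) ℝ, Q.totalDegree ≤ i * F.totalDegree ∧
      ((tangentDeriv F).toLinearMap ^ i) (monomial e 1) = monomial e 1 * Q := by
  induction i with
  | zero => exact ⟨1, by simp, by simp⟩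
  | succ i ih =>
    obtain ⟨Q, hQ, h⟩ := ih
    obtain ⟨L, hL, h'⟩ := exists_tangentDeriv_monomial F hF e
    refine ⟨tangentDeriv F Q + Q * L, ?_, ?_⟩
    · rw [add_mul, one_mul]
      have h1 := totalDegree_tangentDeriv_le F Q hF
      have h2 := totalDegree_mul Q L
      exact (totalDegree_add _ _).trans (max_le (by omega) (by omega))
    · rw [Derivation.toLinearMap_pow_succ_apply, h, Derivation.leibniz, h', smul_eq_mul,
        smul_eq_mul]
      ring

lemma totalDegree_det_le {σ R n : Type*} [CommRing R] [Fintype n] [DecidableEq n] {b : ℕ}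
    (M : Matrix n n (MvPolynomial σ R)) (h : ∀ i j, (M i j).totalDegree ≤ b) :
    M.det.totalDegree ≤ Fintype.card n * b := by
  rw [Matrix.det_apply]
  refine totalDegree_finsetSum_le fun s _ => ?_
  rw [Units.smul_def]
  refine (totalDegree_smul_le _ _).trans ((totalDegree_finsetProd _ _).trans ?_)
  refine (Finset.sum_le_card_nsmul _ _ b fun i _ => h _ _).trans ?_
  rw [Finset.card_univ, smul_eq_mul]

/-- The Wronskian of `k` monomials along the curve `F = 0` is, up to a monomial factor,
a polynomial of degree at most `k² deg F`. -/
lemma exists_wronskian_monomial (F : MvPolynomial (Fin 2) ℝ) (hF : 1 ≤ F.totalDegree)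
    (e : ℕ → Fin 2 →₀ ℕ) (k : ℕ) :
    ∃ T : MvPolynomial (Fin 2) ℝ, T.totalDegree ≤ k ^ 2 * F.totalDegree ∧
      (tangentDeriv F).wronskian (fun j => monomial (e j) 1) k =
        (∏ j : Fin k, monomial (e j) 1) * T := by
  choose Q hQ h using fun j i => exists_tangentDeriv_pow_monomial F hF (e j) i
  refine ⟨(Matrix.of fun i j : Fin k => Q j i).det, ?_, ?_⟩
  · refine (totalDegree_det_le (b := k * F.totalDegree) _ fun i j => ?_).trans ?_
    · exact (hQ _ _).trans (Nat.mul_le_mul_right _ i.2.le)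
    · rw [Fintype.card_fin, sq, mul_assoc]
  · rw [← Matrix.det_mul_row, Derivation.wronskian]
    congr 1
    ext1 i j
    simp only [Matrix.of_apply, h]

lemma Set.finite_and_ncard_le_of_forall_finset {α : Type*} {s : Set α} {n : ℕ}
    (h : ∀ Z : Finset α, (Z : Set α) ⊆ s → Z.card ≤ n) : s.Finite ∧ s.ncard ≤ n := by
  have hs : s.Finite := by
    by_contra hs
    obtain ⟨Z, hZ, hc⟩ := Set.Infinite.exists_subset_card_eq hs (n + 1)
    have := h Z hZ
    omega
  refine ⟨hs, ?_⟩
  rw [Set.ncard_eq_toFinset_card s hs]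
  exact h _ (by simp)

lemma finite_common_zeros {F H : MvPolynomial (Fin 2) ℝ} (hF : Irreducible F) (hFH : ¬ F ∣ H) :
    {p : ℝ × ℝ | eval ![p.1, p.2] F = 0 ∧ eval ![p.1, p.2] H = 0}.Finite ∧
    {p : ℝ × ℝ | eval ![p.1, p.2] F = 0 ∧ eval ![p.1, p.2] H = 0}.ncard ≤
      F.totalDegree * H.totalDegree :=
  Set.finite_and_ncard_le_of_forall_finset fun Z hZ =>
    card_common_zeros_le hF hFH Z fun _ hp => hZ hp

lemma hasStrictFDerivAt_eval_pair (P : MvPolynomial (Fin 2) ℝ) (p : ℝ × ℝ) :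
    HasStrictFDerivAt (fun q : ℝ × ℝ => eval ![q.1, q.2] P)
      (eval ![p.1, p.2] (pderiv 0 P) • ContinuousLinearMap.fst ℝ ℝ ℝ +
        eval ![p.1, p.2] (pderiv 1 P) • ContinuousLinearMap.snd ℝ ℝ ℝ) p := by
  induction P using MvPolynomial.induction_on with
  | C a => simpa using hasStrictFDerivAt_const a p
  | add P Q hP hQ =>
    simp only [map_add]
    convert! hP.add hQ using 1
    module
  | mul_X P i hP =>
    have hX : HasStrictFDerivAt (fun q : ℝ × ℝ => eval ![q.1, q.2] (X i : MvPolynomial (Fin 2) ℝ))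
        (eval ![p.1, p.2] (pderiv 0 (X i : MvPolynomial (Fin 2) ℝ)) •
          ContinuousLinearMap.fst ℝ ℝ ℝ +
        eval ![p.1, p.2] (pderiv 1 (X i : MvPolynomial (Fin 2) ℝ)) •
          ContinuousLinearMap.snd ℝ ℝ ℝ) p := by
      fin_cases i
      · simpa [pderiv_X] using (hasStrictFDerivAt_fst : HasStrictFDerivAt Prod.fst _ p)
      · simpa [pderiv_X] using (hasStrictFDerivAt_snd : HasStrictFDerivAt Prod.snd _ p)
    simp only [map_mul, pderiv_mul, map_add]
    convert! hP.mul hX using 1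
    module

lemma hasDerivAt_eval_graph (P : MvPolynomial (Fin 2) ℝ) {φ : ℝ → ℝ} {φ' x : ℝ}
    (h : HasDerivAt φ φ' x) :
    HasDerivAt (fun x => eval ![x, φ x] P)
      (eval ![x, φ x] (pderiv 0 P) + φ' * eval ![x, φ x] (pderiv 1 P)) x := by
  have := (hasStrictFDerivAt_eval_pair P (x, φ x)).hasFDerivAt.comp_hasDerivAt x
    ((hasDerivAt_id x).prodMk h)
  convert! this using 1
  simp
  ring

/-- The graph of `φ` over the open interval `I` is contained in the curve `F = 0`, and avoids the
coordinate axes and the points where the tangent is vertical. -/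
structure IsArc (F : MvPolynomial (Fin 2) ℝ) (I : Set ℝ) (φ : ℝ → ℝ) : Prop where
  isOpen : IsOpen I
  ordConnected : I.OrdConnected
  eval_eq_zero : ∀ x ∈ I, eval ![x, φ x] F = 0
  eval_ne_zero : ∀ x ∈ I, eval ![x, φ x] (X 0 * X 1 * pderiv 1 F) ≠ 0
  hasDerivAt : ∀ x ∈ I,
    HasDerivAt φ (-eval ![x, φ x] (pderiv 0 F) / eval ![x, φ x] (pderiv 1 F)) x

namespace IsArc

variable {F : MvPolynomial (Fin 2) ℝ} {I : Set ℝ} {φ : ℝ → ℝ}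

lemma mono (h : IsArc F I φ) {J : Set ℝ} (hJ : IsOpen J) (hJ' : J.OrdConnected) (hJI : J ⊆ I) :
    IsArc F J φ :=
  ⟨hJ, hJ', fun x hx => h.eval_eq_zero x (hJI hx), fun x hx => h.eval_ne_zero x (hJI hx),
    fun x hx => h.hasDerivAt x (hJI hx)⟩

lemma hasDerivAt_eval (h : IsArc F I φ) (P : MvPolynomial (Fin 2) ℝ) {x : ℝ} (hx : x ∈ I) :
    HasDerivAt (fun x => eval ![x, φ x] P)
      (eval ![x, φ x] (tangentDeriv F P) / eval ![x, φ x] (X 0 * X 1 * pderiv 1 F)) x := by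
  convert! hasDerivAt_eval_graph P (h.hasDerivAt x hx) using 1
  have h0 := h.eval_ne_zero x hx
  rw [tangentDeriv_apply]
  simp only [map_mul, map_sub, eval_X, Matrix.cons_val_zero, Matrix.cons_val_one, mul_ne_zero_iff]
    at h0 ⊢
  obtain ⟨⟨h1, h2⟩, h3⟩ := h0
  field_simp
  ring

lemma finite_zeros (h : IsArc F I φ) (hF : Irreducible F) {P : MvPolynomial (Fin 2) ℝ}
    (hP : ¬ F ∣ P) : {x ∈ I | eval ![x, φ x] P = 0}.Finite := by
  refine Set.Finite.of_finite_image (f := fun x => (x, φ x))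
    ((finite_common_zeros hF hP).1.subset ?_) fun x _ y _ hxy => congrArg Prod.fst hxy
  rintro _ ⟨x, ⟨hx, hx'⟩, rfl⟩
  exact ⟨h.eval_eq_zero x hx, hx'⟩

end IsArc

/-- A quantitative form of Rolle's theorem for the quotient `u / w`. -/
lemma ncard_zeros_le_of_wronskian {I : Set ℝ} (hI : I.OrdConnected) {u w u' w' : ℝ → ℝ}
    (hu : ∀ x ∈ I, HasDerivAt u (u' x) x) (hw : ∀ x ∈ I, HasDerivAt w (w' x) x) {B : Set ℝ}
    (hB : B.Finite) (hwI : {x ∈ I | w x = 0}.Finite)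
    (h : ∀ x ∈ I, u' x * w x - u x * w' x = 0 → x ∈ B) :
    {x ∈ I | u x = 0}.Finite ∧
      {x ∈ I | u x = 0}.ncard ≤ 2 * {x ∈ I | w x = 0}.ncard + B.ncard + 1 := by
  classical
  have key : {x ∈ I | u x = 0 ∧ w x ≠ 0}.Finite ∧
      {x ∈ I | u x = 0 ∧ w x ≠ 0}.ncard ≤ ({x ∈ I | w x = 0} ∪ B).ncard + 1 := by
    refine Set.finite_and_ncard_le_of_forall_finset fun Z hZ => ?_
    rw [Set.ncard_eq_toFinset_card _ (hwI.union hB)]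
    refine Finset.card_le_of_interleaved fun a ha b hb hab _ => ?_
    obtain ⟨haI, hua, hwa⟩ := hZ ha
    obtain ⟨hbI, hub, hwb⟩ := hZ hb
    have hsub : Set.Icc a b ⊆ I := hI.out haI hbI
    by_cases hz : ∃ z ∈ Set.Icc a b, w z = 0
    · obtain ⟨z, hz, hwz⟩ := hz
      refine ⟨z, by simp [hsub hz, hwz], lt_of_le_of_ne hz.1 ?_, lt_of_le_of_ne hz.2 ?_⟩
      · rintro rfl
        exact hwa hwz
      · rintro rfl
        exact hwb hwz
    · push Not at hz
      have hd : ∀ x ∈ Set.Icc a b, HasDerivAt (fun x => u x / w x)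
          ((u' x * w x - u x * w' x) / w x ^ 2) x := fun x hx =>
        (hu x (hsub hx)).div (hw x (hsub hx)) (hz x hx)
      obtain ⟨c, hc, hc'⟩ := exists_hasDerivAt_eq_zero hab
        (fun x hx => (hd x hx).continuousAt.continuousWithinAt) (by simp [hua, hub])
        (fun x hx => hd x (Set.Ioo_subset_Icc_self hx))
      have hcI := Set.Ioo_subset_Icc_self hc
      refine ⟨c, ?_, hc.1, hc.2⟩
      have := h c (hsub hcI) ((div_eq_zero_iff.1 hc').resolve_right (pow_ne_zero 2 (hz c hcI)))
      simp [this]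
  have hsub : {x ∈ I | u x = 0} ⊆ {x ∈ I | u x = 0 ∧ w x ≠ 0} ∪ {x ∈ I | w x = 0} := by
    rintro x ⟨hx, hux⟩
    by_cases hwx : w x = 0
    · exact Or.inr ⟨hx, hwx⟩
    · exact Or.inl ⟨hx, hux, hwx⟩
  have hfin := key.1.union hwI
  refine ⟨hfin.subset hsub, ?_⟩
  have h1 := Set.ncard_le_ncard hsub hfin
  have h2 := Set.ncard_union_le {x ∈ I | u x = 0 ∧ w x ≠ 0} {x ∈ I | w x = 0}
  have h3 := Set.ncard_union_le {x ∈ I | w x = 0} B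
  have h4 := key.2
  omega

namespace IsArc

variable {F : MvPolynomial (Fin 2) ℝ} {I : Set ℝ} {φ : ℝ → ℝ}

/-- If the Wronskian `W(g 0, …, g (n - 1), f)` vanishes along an arc on which no smaller Wronskian
vanishes, then `f` is a linear combination of `g 0, …, g (n - 1)` along this arc. -/
lemma exists_eq_sum_of_wronskian_eq_zero (h : IsArc F I φ) (hI : I.Nonempty)
    (g : ℕ → MvPolynomial (Fin 2) ℝ) (n : ℕ)
    (hW : ∀ j ≤ n, ∀ x ∈ I, eval ![x, φ x] ((tangentDeriv F).wronskian g j) ≠ 0)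
    (f : MvPolynomial (Fin 2) ℝ)
    (hf : ∀ x ∈ I, eval ![x, φ x]
      ((tangentDeriv F).wronskian (Function.update g n f) (n + 1)) = 0) :
    ∃ c : ℕ → ℝ, ∀ x ∈ I, eval ![x, φ x] (f - ∑ j ∈ Finset.range n, c j • g j) = 0 := by
  induction n generalizing f with
  | zero =>
    refine ⟨0, fun x hx => ?_⟩
    have := hf x hx
    rw [Derivation.wronskian] at this
    simpa using this
  | succ n ih =>
    set D := tangentDeriv F
    obtain ⟨x₀, hx₀⟩ := hI
    have hWn : D.wronskian g n ≠ 0 := fun h0 => hW n (by omega) x₀ hx₀ (by rw [h0, map_zero])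
    have hid := D.wronskian_mul_wronskian g n hWn f
    set U := D.wronskian (Function.update g n f) (n + 1)
    have hd : ∀ x ∈ I, HasDerivAt
        (fun x => eval ![x, φ x] U / eval ![x, φ x] (D.wronskian g (n + 1))) 0 x := by
      intro x hx
      convert! (h.hasDerivAt_eval U hx).div (h.hasDerivAt_eval (D.wronskian g (n + 1)) hx)
        (hW (n + 1) le_rfl x hx) using 1
      have h1 := congrArg (eval ![x, φ x]) hid
      rw [map_mul, hf x hx, mul_zero, map_sub, map_mul, map_mul] at h1
      symm
      rw [div_eq_zero_iff]
      left
      rw [div_mul_eq_mul_div, mul_div_assoc', ← sub_div, div_eq_zero_iff]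
      left
      linarith
    obtain ⟨c, hc⟩ := h.isOpen.exists_is_const_of_deriv_eq_zero
      h.ordConnected.isPreconnected
      (fun x hx => (hd x hx).differentiableAt.differentiableWithinAt) (fun x hx => (hd x hx).deriv)
    obtain ⟨c', hc'⟩ := ih (fun j hj => hW j (by omega)) (f - c • g n) (fun x hx => by
      have h1 := hc x hx
      rw [div_eq_iff (hW (n + 1) le_rfl x hx)] at h1
      rw [Derivation.wronskian_update_sub_smul, map_sub, smul_eval, h1, sub_self])
    refine ⟨Function.update c' n c, fun x hx => ?_⟩
    rw [← hc' x hx, Finset.sum_range_succ, Function.update_self, Finset.sum_congr rfl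
      fun j hj => by rw [Function.update_of_ne (Finset.mem_range.1 hj).ne]]
    congr 1
    ring

lemma not_dvd_wronskian (h : IsArc F I φ) (hI : I.Nonempty) (hF : Irreducible F)
    (g : ℕ → MvPolynomial (Fin 2) ℝ) (t : ℕ)
    (hg : ∀ k < t, ∀ c : ℕ → ℝ, ¬ F ∣ g k - ∑ j ∈ Finset.range k, c j • g j) (k : ℕ)
    (hk : k ≤ t) : ¬ F ∣ (tangentDeriv F).wronskian g k := by
  induction k using Nat.strong_induction_on with
  | _ k ih =>
    rcases k with _ | k
    · rw [Derivation.wronskian_zero]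
      exact fun h1 => hF.not_isUnit (isUnit_of_dvd_one h1)
    · intro hdvd
      set D := tangentDeriv F
      have hfin : (⋃ j ∈ Set.Iic k, {x ∈ I | eval ![x, φ x] (D.wronskian g j) = 0}).Finite :=
        (Set.finite_Iic k).biUnion fun j hj => h.finite_zeros hF
          (ih j (Nat.lt_succ_of_le hj) (le_trans (le_trans hj (Nat.le_succ k)) hk))
      have hopen := h.isOpen.sdiff hfin.isClosed
      obtain ⟨x₀, hx₀⟩ : (I \ ⋃ j ∈ Set.Iic k,
          {x ∈ I | eval ![x, φ x] (D.wronskian g j) = 0}).Nonempty := by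
        obtain ⟨y, hy⟩ := hI
        exact ((infinite_of_mem_nhds y (h.isOpen.mem_nhds hy)).sdiff hfin).nonempty
      obtain ⟨ε, hε, hball⟩ := Metric.isOpen_iff.1 hopen x₀ hx₀
      have harc := h.mono Metric.isOpen_ball (by
        rw [Real.ball_eq_Ioo]; exact Set.ordConnected_Ioo) (hball.trans Set.sdiff_subset)
      obtain ⟨c, hc⟩ := harc.exists_eq_sum_of_wronskian_eq_zero ⟨x₀, Metric.mem_ball_self hε⟩ g k
        (fun j hj x hx h0 => (hball hx).2 (Set.mem_biUnion (Set.mem_Iic.2 hj)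
          ⟨(hball hx).1, h0⟩)) (g k) (fun x hx => by
          rw [Function.update_eq_self]
          obtain ⟨Q, hQ⟩ := hdvd
          rw [hQ, map_mul, harc.eval_eq_zero x hx, zero_mul])
      have := harc.finite_zeros hF (hg k hk c)
      refine infinite_of_mem_nhds x₀ (Metric.ball_mem_nhds x₀ hε) (this.subset fun x hx => ?_)
      exact ⟨hx, hc x hx⟩

lemma ncard_zeros_le (h : IsArc F I φ) (hF : Irreducible F)
    (g : ℕ → MvPolynomial (Fin 2) ℝ) (t : ℕ)
    (hW : ∀ k ≤ t, ¬ F ∣ (tangentDeriv F).wronskian g k) (c : ℕ → ℝ) (n i : ℕ)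
    (hn : n + i + 1 = t) (hc : c (n + i) ≠ 0) :
    {x ∈ I | eval ![x, φ x] ((tangentDeriv F).wronskian
      (Function.update g n (∑ j ∈ Finset.range t, c j • g j)) (n + 1)) = 0}.Finite ∧
    {x ∈ I | eval ![x, φ x] ((tangentDeriv F).wronskian
      (Function.update g n (∑ j ∈ Finset.range t, c j • g j)) (n + 1)) = 0}.ncard ≤
      i + {x ∈ I | eval ![x, φ x] ((tangentDeriv F).wronskian g n) = 0}.ncard +
      3 * ∑ k ∈ Finset.Ico (n + 1) (t + 1),
        {x ∈ I | eval ![x, φ x] ((tangentDeriv F).wronskian g k) = 0}.ncard := by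
  set D := tangentDeriv F
  induction i generalizing n with
  | zero =>
    subst hn
    have h1 := D.wronskian_update_sum g n c
    simp only [add_zero] at hc ⊢
    simp only [h1, smul_eval, mul_eq_zero, hc, false_or]
    refine ⟨h.finite_zeros hF (hW _ le_rfl), ?_⟩
    rw [Nat.Ico_succ_singleton, Finset.sum_singleton]
    omega
  | succ i ih =>
    obtain ⟨h1, h2⟩ := ih (n + 1) (by omega) (by rwa [add_assoc, add_comm 1 i])
    have hWn : D.wronskian g n ≠ 0 := fun h0 => hW n (by omega) (h0 ▸ dvd_zero F)
    have hid := D.wronskian_mul_wronskian g n hWn (∑ j ∈ Finset.range t, c j • g j)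
    have hWfin := h.finite_zeros hF (hW n (by omega))
    obtain ⟨h3, h4⟩ := ncard_zeros_le_of_wronskian h.ordConnected
      (fun x hx => h.hasDerivAt_eval (D.wronskian
        (Function.update g n (∑ j ∈ Finset.range t, c j • g j)) (n + 1)) hx)
      (fun x hx => h.hasDerivAt_eval (D.wronskian g (n + 1)) hx) (hWfin.union h1)
      (h.finite_zeros hF (hW (n + 1) (by omega))) (by
        intro x hx hx0
        rw [div_mul_eq_mul_div, mul_div_assoc', ← sub_div, div_eq_zero_iff] at hx0
        have hx1 := hx0.resolve_right (h.eval_ne_zero x hx)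
        have hx2 := congrArg (eval ![x, φ x]) hid
        rw [map_mul, map_sub, map_mul, map_mul] at hx2
        have hx3 : eval ![x, φ x] (D.wronskian g n) * eval ![x, φ x] (D.wronskian
          (Function.update g (n + 1) (∑ j ∈ Finset.range t, c j • g j)) (n + 2)) = 0 := by
          rw [hx2]
          linarith
        rcases mul_eq_zero.1 hx3 with h0 | h0
        · exact Or.inl ⟨hx, h0⟩
        · exact Or.inr ⟨hx, h0⟩)
    refine ⟨h3, ?_⟩
    have h5 := Set.ncard_union_le {x ∈ I | eval ![x, φ x] (D.wronskian g n) = 0}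
      {x ∈ I | eval ![x, φ x] (D.wronskian
      (Function.update g (n + 1) (∑ j ∈ Finset.range t, c j • g j)) (n + 1 + 1)) = 0}
    rw [Finset.sum_eq_sum_Ico_succ_bot (by omega)]
    omega

/-- A Voorhoeve–van der Poorten type bound for the number of zeros of a linear combination in
terms of the zeros of Wronskians. -/
theorem ncard_zeros_sum_le (h : IsArc F I φ) (hF : Irreducible F)
    (g : ℕ → MvPolynomial (Fin 2) ℝ) (t : ℕ)
    (hW : ∀ k ≤ t + 1, ¬ F ∣ (tangentDeriv F).wronskian g k) (c : ℕ → ℝ) (hc : c t ≠ 0) :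
    {x ∈ I | eval ![x, φ x] (∑ j ∈ Finset.range (t + 1), c j • g j) = 0}.Finite ∧
    {x ∈ I | eval ![x, φ x] (∑ j ∈ Finset.range (t + 1), c j • g j) = 0}.ncard ≤
      t + 3 * ∑ k ∈ Finset.Ico 1 (t + 2),
        {x ∈ I | eval ![x, φ x] ((tangentDeriv F).wronskian g k) = 0}.ncard := by
  have := h.ncard_zeros_le hF g (t + 1) hW c 0 t (by omega) (by rwa [zero_add])
  simpa [Derivation.wronskian] using this

end IsArc

/-- A polynomial in two variables as a polynomial in the second one with polynomial
coefficients. -/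
noncomputable def toBivariate (F : MvPolynomial (Fin 2) ℝ) : Polynomial (Polynomial ℝ) :=
  aeval ![Polynomial.C Polynomial.X, Polynomial.X] F

/-- The univariate polynomial `F(x, Y)`. -/
noncomputable def specialize (F : MvPolynomial (Fin 2) ℝ) (x : ℝ) : Polynomial ℝ :=
  (toBivariate F).map (Polynomial.evalRingHom x)

lemma eval_specialize (F : MvPolynomial (Fin 2) ℝ) (x y : ℝ) :
    (specialize F x).eval y = eval ![x, y] F := by
  have : ((Polynomial.evalRingHom y).comp ((Polynomial.mapRingHom (Polynomial.evalRingHom x)).comp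
      (aeval (R := ℝ) ![Polynomial.C Polynomial.X, Polynomial.X] :
        MvPolynomial (Fin 2) ℝ →ₐ[ℝ] Polynomial (Polynomial ℝ)).toRingHom)) =
      eval ![x, y] := by
    refine MvPolynomial.ringHom_ext (fun r => ?_) (fun i => ?_)
    · simp [Polynomial.algebraMap_apply]
    · fin_cases i <;> simp
  exact DFunLike.congr_fun this F

lemma toBivariate_ne_zero {F : MvPolynomial (Fin 2) ℝ} (hF : F ≠ 0) : toBivariate F ≠ 0 := by
  intro h
  refine hF (MvPolynomial.funext fun v => ?_)
  have := eval_specialize F (v 0) (v 1)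
  rw [specialize, h] at this
  rw [map_zero, show v = ![v 0, v 1] by ext i; fin_cases i <;> rfl, ← this]
  simp

lemma natDegree_toBivariate_le (F : MvPolynomial (Fin 2) ℝ) :
    (toBivariate F).natDegree ≤ F.totalDegree := by
  rw [toBivariate, aeval_def, eval₂]
  refine Polynomial.natDegree_sum_le_of_forall_le _ _ fun m hm => ?_
  have h := le_totalDegree hm
  rw [Finsupp.sum_fintype _ _ fun _ => rfl, Fin.sum_univ_two] at h
  beta_reduce
  rw [Finsupp.prod_fintype _ _ fun _ => pow_zero _, Fin.prod_univ_two]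
  simp only [Matrix.cons_val_zero, Matrix.cons_val_one, Polynomial.algebraMap_apply,
    ← Polynomial.C_pow, ← mul_assoc, ← Polynomial.C_mul]
  exact (Polynomial.natDegree_C_mul_X_pow_le _ _).trans (by omega)

lemma natDegree_coeff_toBivariate_le (F : MvPolynomial (Fin 2) ℝ) (j : ℕ) :
    ((toBivariate F).coeff j).natDegree ≤ F.totalDegree := by
  rw [toBivariate, aeval_def, eval₂, Finsupp.sum, Polynomial.finsetSum_coeff]
  refine Polynomial.natDegree_sum_le_of_forall_le _ _ fun m hm => ?_
  have h := le_totalDegree hm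
  rw [Finsupp.sum_fintype _ _ fun _ => rfl, Fin.sum_univ_two] at h
  rw [Finsupp.prod_fintype _ _ fun _ => pow_zero _, Fin.prod_univ_two]
  simp only [Matrix.cons_val_zero, Matrix.cons_val_one, Polynomial.algebraMap_apply,
    ← Polynomial.C_pow, ← mul_assoc, ← Polynomial.C_mul, Polynomial.coeff_C_mul_X_pow]
  split_ifs
  · exact (Polynomial.natDegree_C_mul_X_pow_le _ _).trans (by omega)
  · simp

/-- The roots of `F(x, Y)`. -/
noncomputable def fiber (F : MvPolynomial (Fin 2) ℝ) (x : ℝ) : Finset ℝ :=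
  (specialize F x).roots.toFinset

lemma mem_fiber {F : MvPolynomial (Fin 2) ℝ} {x : ℝ} (hx : specialize F x ≠ 0) {y : ℝ} :
    y ∈ fiber F x ↔ eval ![x, y] F = 0 := by
  rw [fiber, Multiset.mem_toFinset, Polynomial.mem_roots hx, Polynomial.IsRoot, eval_specialize]

lemma card_fiber_le (F : MvPolynomial (Fin 2) ℝ) (x : ℝ) : (fiber F x).card ≤ F.totalDegree :=
  (Multiset.toFinset_card_le _).trans <| (Polynomial.card_roots' _).trans <|
    Polynomial.natDegree_map_le.trans (natDegree_toBivariate_le F)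

lemma eventually_abs_le_of_leadingCoeff_ne_zero {F : MvPolynomial (Fin 2) ℝ} {x₀ : ℝ}
    (h : (toBivariate F).leadingCoeff.eval x₀ ≠ 0) :
    ∃ R : ℝ, ∀ᶠ x in nhds x₀, ∀ y ∈ fiber F x, y ∈ Set.Icc (-R) R := by
  set P := toBivariate F
  set b : ℝ → NNReal := fun x =>
    ((Finset.range P.natDegree).sup fun i => ‖(P.coeff i).eval x‖₊) /
      ‖P.leadingCoeff.eval x‖₊ + 1
  have hb : ContinuousAt b x₀ := by
    refine ContinuousAt.add (ContinuousAt.div ?_ ?_ (by simpa using h)) continuousAt_const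
    · exact ContinuousAt.finset_sup_apply fun i _ => (P.coeff i).continuous.nnnorm.continuousAt
    · exact P.leadingCoeff.continuous.nnnorm.continuousAt
  have h1 : ∀ᶠ x in nhds x₀, P.leadingCoeff.eval x ≠ 0 :=
    P.leadingCoeff.continuous.continuousAt.eventually_ne h
  have h2 : ∀ᶠ x in nhds x₀, b x < b x₀ + 1 :=
    hb.eventually_lt continuousAt_const (lt_add_one _)
  refine ⟨(b x₀ + 1 : NNReal), ?_⟩
  filter_upwards [h1, h2] with x hx1 hx2 y hy
  rw [fiber, Multiset.mem_toFinset] at hy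
  have h3 := (Polynomial.isRoot_of_mem_roots hy).norm_lt_cauchyBound
    (Polynomial.ne_zero_of_mem_roots hy)
  have h4 : (specialize F x).cauchyBound = b x := by
    rw [Polynomial.cauchyBound, specialize,
      Polynomial.natDegree_map_of_leadingCoeff_ne_zero _ hx1,
      Polynomial.leadingCoeff_map_of_leadingCoeff_ne_zero _ hx1]
    simp [b, P]
  rw [h4] at h3
  have h5 : ‖y‖₊ ≤ b x₀ + 1 := (h3.trans hx2).le
  rw [← NNReal.coe_le_coe, coe_nnnorm, Real.norm_eq_abs] at h5
  exact abs_le.1 h5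

/-- The `i`-th smallest point of the fiber, if it exists. -/
noncomputable def sheet (F : MvPolynomial (Fin 2) ℝ) (i : ℕ) (x : ℝ) : ℝ :=
  if h : i < (fiber F x).card then (fiber F x).orderEmbOfFin rfl ⟨i, h⟩ else 0

lemma sheet_mem_fiber {F : MvPolynomial (Fin 2) ℝ} {i : ℕ} {x : ℝ} (h : i < (fiber F x).card) :
    sheet F i x ∈ fiber F x := by
  rw [sheet, dif_pos h]
  exact Finset.orderEmbOfFin_mem _ _ _

lemma sheet_injOn (F : MvPolynomial (Fin 2) ℝ) (x : ℝ) :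
    Set.InjOn (fun i => sheet F i x) (Set.Iio (fiber F x).card) := by
  intro i hi j hj hij
  rw [Set.mem_Iio] at hi hj
  simp only [sheet, dif_pos hi, dif_pos hj] at hij
  simpa using hij

lemma exists_sheet_eq {F : MvPolynomial (Fin 2) ℝ} {x y : ℝ} (hy : y ∈ fiber F x) :
    ∃ i < (fiber F x).card, sheet F i x = y := by
  have : y ∈ Set.range ((fiber F x).orderEmbOfFin rfl) := by
    rw [Finset.range_orderEmbOfFin]
    exact hy
  obtain ⟨⟨i, hi⟩, h⟩ := this
  exact ⟨i, hi, by rw [sheet, dif_pos hi, h]⟩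

/-- The local form of the implicit function theorem for plane curves. -/
lemma exists_implicitFunction {F : MvPolynomial (Fin 2) ℝ} {x₀ y₀ : ℝ}
    (h : eval ![x₀, y₀] F = 0) (h' : eval ![x₀, y₀] (pderiv 1 F) ≠ 0) :
    ∃ ψ : ℝ → ℝ, ψ x₀ = y₀ ∧
      HasDerivAt ψ (-eval ![x₀, y₀] (pderiv 0 F) / eval ![x₀, y₀] (pderiv 1 F)) x₀ ∧
      (∀ᶠ x in nhds x₀, eval ![x, ψ x] F = 0) ∧
      ∀ᶠ p : ℝ × ℝ in nhds (x₀, y₀), eval ![p.1, p.2] F = 0 → ψ p.1 = p.2 := by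
  have hd := hasStrictFDerivAt_eval_pair F (x₀, y₀)
  set a := eval ![x₀, y₀] (pderiv 0 F)
  set b := eval ![x₀, y₀] (pderiv 1 F)
  have hinv : ((a • ContinuousLinearMap.fst ℝ ℝ ℝ + b • ContinuousLinearMap.snd ℝ ℝ ℝ) ∘L
      .inr ℝ ℝ ℝ).IsInvertible := by
    refine ⟨ContinuousLinearEquiv.unitsEquivAut ℝ (Units.mk0 b h'), ?_⟩
    ext
    simp
  have h1 := hd.eventually_apply_eq_iff_implicitFunctionOfProdDomain hinv
  have h2 := hd.eventually_apply_implicitFunctionOfProdDomain hinv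
  have h3 := (hd.hasStrictFDerivAt_implicitFunctionOfProdDomain hinv).hasFDerivAt
  set ψ := hd.implicitFunctionOfProdDomain hinv
  have h0 : ψ x₀ = y₀ := h1.self_of_nhds.1 rfl
  simp only [h] at h1 h2
  have h4 := h3.hasDerivAt
  refine ⟨ψ, h0, ?_, h2, h1.mono fun p hp => hp.1⟩
  convert! h4 using 1
  have h5 : b * ((a • ContinuousLinearMap.fst ℝ ℝ ℝ + b • ContinuousLinearMap.snd ℝ ℝ ℝ) ∘L
      .inr ℝ ℝ ℝ).inverse 1 = 1 := by
    simpa using hinv.self_apply_inverse 1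
  rw [div_eq_iff h']
  simp at h5 ⊢
  linear_combination -a * h5

lemma eventually_card_fiber_and_hasDerivAt_sheet {F : MvPolynomial (Fin 2) ℝ} {x₀ : ℝ}
    (hsp : ∀ x, specialize F x ≠ 0) (hl : (toBivariate F).leadingCoeff.eval x₀ ≠ 0)
    (hs : ∀ y ∈ fiber F x₀, eval ![x₀, y] (pderiv 1 F) ≠ 0) :
    (∀ᶠ x in nhds x₀, (fiber F x).card = (fiber F x₀).card) ∧
    ∀ i < (fiber F x₀).card, HasDerivAt (sheet F i)
      (-eval ![x₀, sheet F i x₀] (pderiv 0 F) / eval ![x₀, sheet F i x₀] (pderiv 1 F)) x₀ := by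
  classical
  set n := (fiber F x₀).card with hn
  set s : Fin n → ℝ := ⇑((fiber F x₀).orderEmbOfFin rfl)
  have hs_mem : ∀ i, s i ∈ fiber F x₀ := fun i => Finset.orderEmbOfFin_mem _ _ _
  have hs_mono : StrictMono s := ((fiber F x₀).orderEmbOfFin rfl).strictMono
  choose ψ h0 hψd hψF hψ using fun i : Fin n =>
    exists_implicitFunction ((mem_fiber (hsp x₀)).1 (hs_mem i)) (hs _ (hs_mem i))
  have hmono : ∀ᶠ x in nhds x₀, StrictMono fun i => ψ i x := by
    have : ∀ i j, i < j → ∀ᶠ x in nhds x₀, ψ i x < ψ j x := fun i j hij =>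
      (hψd i).continuousAt.eventually_lt (hψd j).continuousAt (by
        rw [h0, h0]
        exact hs_mono hij)
    have h2 : ∀ᶠ x in nhds x₀, ∀ i j, i < j → ψ i x < ψ j x := by
      simp only [Filter.eventually_all]
      exact this
    exact h2.mono fun x hx i j hij => hx i j hij
  have hmem : ∀ᶠ x in nhds x₀, ∀ i, ψ i x ∈ fiber F x := by
    rw [Filter.eventually_all]
    exact fun i => (hψF i).mono fun x hx => (mem_fiber (hsp x)).2 hx
  obtain ⟨R, hR⟩ := eventually_abs_le_of_leadingCoeff_ne_zero hl
  have hloc : ∀ᶠ x in nhds x₀, ∀ y ∈ Set.Icc (-R) R, eval ![x, y] F = 0 → ∃ i, ψ i x = y := by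
    refine isCompact_Icc.eventually_forall_of_forall_eventually fun y _ => ?_
    by_cases hy : eval ![x₀, y] F = 0
    · have : y ∈ Set.range s := by
        rw [Finset.range_orderEmbOfFin]
        exact (mem_fiber (hsp x₀)).2 hy
      obtain ⟨i, rfl⟩ := this
      exact (hψ i).mono fun p hp hp0 => ⟨i, hp hp0⟩
    · have : ∀ᶠ p : ℝ × ℝ in nhds (x₀, y), eval ![p.1, p.2] F ≠ 0 :=
        (hasStrictFDerivAt_eval_pair F (x₀, y)).hasFDerivAt.continuousAt.eventually_ne hy
      exact this.mono fun p hp hp0 => absurd hp0 hp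
  have hcard : ∀ᶠ x in nhds x₀, (fiber F x).card = n := by
    filter_upwards [hmono, hmem, hR, hloc] with x h1 h2 h3 h4
    have : fiber F x = Finset.univ.image fun i => ψ i x := by
      ext y
      simp only [Finset.mem_image, Finset.mem_univ, true_and]
      refine ⟨fun hy => h4 y (h3 y hy) ((mem_fiber (hsp x)).1 hy), ?_⟩
      rintro ⟨i, rfl⟩
      exact h2 i
    rw [this, Finset.card_image_of_injective _ h1.injective, Finset.card_univ, Fintype.card_fin]
  refine ⟨hcard, fun i hi => ?_⟩
  have hev : sheet F i =ᶠ[nhds x₀] ψ ⟨i, hi⟩ := by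
    filter_upwards [hmono, hmem, hcard] with x h1 h2 h3
    have h4 := Finset.orderEmbOfFin_unique h3 h2 h1
    have h5 : ∀ (m : ℕ) (hm : (fiber F x).card = m) (him : i < m),
        sheet F i x = (fiber F x).orderEmbOfFin hm ⟨i, him⟩ := by
      rintro _ rfl him
      rw [sheet, dif_pos him]
    rw [h5 n h3 hi, ← h4]
  have h6 : sheet F i x₀ = s ⟨i, hi⟩ := by rw [sheet, dif_pos hi]
  rw [h6]
  exact (hψd ⟨i, hi⟩).congr_of_eventuallyEq hev

lemma specialize_ne_zero {F : MvPolynomial (Fin 2) ℝ} (hF : Irreducible F)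
    (hY : pderiv 1 F ≠ 0) (x : ℝ) : specialize F x ≠ 0 := by
  intro h
  have h0 : ∀ y, eval ![x, y] F = 0 := fun y => by
    rw [← eval_specialize, h, Polynomial.eval_zero]
  have h1 : ∀ y, eval ![x, y] (pderiv 1 F) = 0 := fun y => by
    have h2 := (hasStrictFDerivAt_eval_pair F (x, y)).hasFDerivAt.comp_hasDerivAt y
      ((hasDerivAt_const y x).prodMk (hasDerivAt_id y))
    have h3 : ((fun q : ℝ × ℝ => eval ![q.1, q.2] F) ∘ Prod.mk x) = fun _ => (0 : ℝ) := by
      ext y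
      exact h0 y
    rw [h3] at h2
    simpa using h2.unique (hasDerivAt_const y 0)
  refine Set.infinite_univ (α := ℝ) (Set.Finite.of_finite_image (f := fun y => (x, y))
    ((finite_common_zeros hF (not_dvd_pderiv hY)).1.subset ?_) fun a _ b _ hab =>
      congrArg Prod.snd hab)
  rintro _ ⟨y, -, rfl⟩
  exact ⟨h0 y, h1 y⟩

/-- The connected components of the complement of a finite set of reals. -/
def gap (Δ : Finset ℝ) (k : ℕ) : Set ℝ :=
  {x | x ∉ Δ ∧ (Δ.filter (· < x)).card = k}

lemma isOpen_gap (Δ : Finset ℝ) (k : ℕ) : IsOpen (gap Δ k) := by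
  rw [isOpen_iff_mem_nhds]
  rintro x₀ ⟨h1, h2⟩
  have h : ∀ᶠ x in nhds x₀, ∀ δ ∈ Δ, x ≠ δ ∧ (δ < x ↔ δ < x₀) := by
    rw [Filter.eventually_all_finset]
    intro δ hδ
    rcases lt_or_gt_of_ne (ne_of_mem_of_not_mem hδ h1) with h | h
    · exact (lt_mem_nhds h).mono fun x hx => ⟨hx.ne', iff_of_true hx h⟩
    · exact (gt_mem_nhds h).mono fun x hx => ⟨hx.ne, iff_of_false hx.le.not_gt h.le.not_gt⟩
  refine Filter.mem_of_superset h fun x hx => ⟨fun hxΔ => (hx x hxΔ).1 rfl, ?_⟩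
  rw [← h2, Finset.filter_congr fun δ hδ => (hx δ hδ).2]

lemma ordConnected_gap (Δ : Finset ℝ) (k : ℕ) : (gap Δ k).OrdConnected := by
  refine ⟨?_⟩
  rintro a ⟨ha1, ha2⟩ b ⟨hb1, hb2⟩ x ⟨hax, hxb⟩
  have h1 : Δ.filter (· < a) ⊆ Δ.filter (· < x) :=
    Finset.monotone_filter_right _ fun δ _ h => h.trans_le hax
  have h2 : Δ.filter (· < x) ⊆ Δ.filter (· < b) :=
    Finset.monotone_filter_right _ fun δ _ h => h.trans_le hxb
  have h3 := Finset.card_le_card h1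
  have h4 := Finset.card_le_card h2
  refine ⟨fun hx => ?_, by omega⟩
  have h5 := Finset.eq_of_subset_of_card_le (h1.trans h2) (by omega)
  have h6 : x ∈ Δ.filter (· < a) := by
    rw [h5, Finset.mem_filter]
    exact ⟨hx, lt_of_le_of_ne hxb fun h => hb1 (h ▸ hx)⟩
  exact absurd (Finset.mem_filter.1 h6).2 (not_lt.2 hax)

lemma mem_gap {Δ : Finset ℝ} {x : ℝ} (hx : x ∉ Δ) :
    ∃ k ∈ Finset.range (Δ.card + 1), x ∈ gap Δ k :=
  ⟨_, Finset.mem_range.2 (Nat.lt_succ_of_le (Finset.card_filter_le _ _)), hx, rfl⟩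

lemma one_le_totalDegree_of_pderiv_ne_zero {σ R : Type*} [CommSemiring R]
    {F : MvPolynomial σ R} {i : σ} (h : pderiv i F ≠ 0) : 1 ≤ F.totalDegree := by
  by_contra! h0
  apply h
  rw [totalDegree_eq_zero_iff_eq_C.1 (Nat.lt_one_iff.1 h0), pderiv_C]

/-- The part of the gap over which the `i`-th sheet of the curve exists. -/
def arcDomain (F : MvPolynomial (Fin 2) ℝ) (Δ : Finset ℝ) (q : ℕ × ℕ) : Set ℝ :=
  {x | x ∈ gap Δ q.1 ∧ q.2 < (fiber F x).card}

/-- Away from finitely many vertical lines, a plane curve is a union of arcs. -/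
theorem exists_isArc_arcDomain {F : MvPolynomial (Fin 2) ℝ} (hF : Irreducible F)
    (hY : pderiv 1 F ≠ 0) (hX : ¬ F ∣ X 1) :
    ∃ Δ : Finset ℝ, Δ.card ≤ 3 * F.totalDegree ^ 2 ∧
      ∀ q, IsArc F (arcDomain F Δ q) (sheet F q.2) := by
  classical
  have hsp := specialize_ne_zero hF hY
  have hX0 : ¬ F ∣ X 0 := by
    rintro ⟨q, hq⟩
    have h1 := congrArg (pderiv 1) hq
    rw [pderiv_X_of_ne (by simp), pderiv_mul] at h1
    have h2 : F ∣ pderiv 1 F * q := ⟨-pderiv 1 q, by linear_combination -h1⟩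
    obtain ⟨r, rfl⟩ := (hF.prime.dvd_or_dvd h2).resolve_left (not_dvd_pderiv hY)
    have h3 := congrArg (pderiv 0) hq
    rw [pderiv_X_self, pderiv_mul, pderiv_mul] at h3
    exact hF.not_isUnit (isUnit_of_dvd_one
      ⟨pderiv 0 F * r + (pderiv 0 F * r + F * pderiv 0 r), by rw [h3]; ring⟩)
  have hd := one_le_totalDegree_of_pderiv_ne_zero hY
  have hH : ¬ F ∣ X 0 * X 1 * pderiv 1 F := fun h =>
    (hF.prime.dvd_or_dvd h).elim (fun h => (hF.prime.dvd_or_dvd h).elim hX0 hX)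
      (not_dvd_pderiv hY)
  have hHd : (X 0 * X 1 * pderiv 1 F).totalDegree ≤ F.totalDegree + 1 := by
    have h1 := totalDegree_mul (X 0 * X 1) (pderiv 1 F)
    have h2 := totalDegree_mul (X 0 : MvPolynomial (Fin 2) ℝ) (X 1)
    have h3 := totalDegree_pderiv_le 1 F
    rw [totalDegree_X, totalDegree_X] at h2
    omega
  obtain ⟨hfin, hcard⟩ := finite_common_zeros hF hH
  have hl : (toBivariate F).leadingCoeff ≠ 0 :=
    Polynomial.leadingCoeff_ne_zero.2 (toBivariate_ne_zero hF.ne_zero)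
  set Δ : Finset ℝ := (toBivariate F).leadingCoeff.roots.toFinset ∪ hfin.toFinset.image Prod.fst
    with hΔ
  have hgap : ∀ {k x}, x ∈ gap Δ k → (toBivariate F).leadingCoeff.eval x ≠ 0 ∧
      ∀ y ∈ fiber F x, eval ![x, y] (X 0 * X 1 * pderiv 1 F) ≠ 0 := by
    rintro k x ⟨hx, -⟩
    rw [hΔ, Finset.notMem_union] at hx
    refine ⟨fun h => hx.1 ?_, fun y hy h => hx.2 (Finset.mem_image.2 ⟨(x, y), ?_, rfl⟩)⟩
    · rw [Multiset.mem_toFinset, Polynomial.mem_roots hl]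
      exact h
    · rw [Set.Finite.mem_toFinset]
      exact ⟨(mem_fiber (hsp x)).1 hy, h⟩
  have hloc : ∀ {k x}, x ∈ gap Δ k → _ := fun {k x} hx =>
    eventually_card_fiber_and_hasDerivAt_sheet hsp (hgap hx).1 fun y hy h0 =>
      (hgap hx).2 y hy (by rw [map_mul, h0, mul_zero])
  have hconst : ∀ {k x₀ x}, x₀ ∈ gap Δ k → x ∈ gap Δ k →
      (fiber F x).card = (fiber F x₀).card := fun {k x₀ x} hx₀ hx =>
    (ordConnected_gap Δ k).isPreconnected.constant (f := fun x => (fiber F x).card)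
      (fun y hy => (continuousAt_const.congr
        ((hloc hy).1.mono fun _ h => h.symm)).continuousWithinAt) hx hx₀
  have hdom : ∀ q, arcDomain F Δ q = ∅ ∨ arcDomain F Δ q = gap Δ q.1 := fun q => by
    rw [or_iff_not_imp_left, ← Ne, ← Set.nonempty_iff_ne_empty]
    rintro ⟨x₀, hx₀, hi⟩
    exact Set.Subset.antisymm (fun x hx => hx.1) fun x hx => ⟨hx, by rwa [hconst hx₀ hx]⟩
  refine ⟨Δ, ?_, fun q => ⟨?_, ?_, fun z hz => ?_, fun z hz => ?_, fun z hz => ?_⟩⟩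
  · have h1 : (toBivariate F).leadingCoeff.roots.toFinset.card ≤ F.totalDegree :=
      (Multiset.toFinset_card_le _).trans <| (Polynomial.card_roots' _).trans
        (natDegree_coeff_toBivariate_le F _)
    have h2 : (hfin.toFinset.image Prod.fst).card ≤ F.totalDegree * (F.totalDegree + 1) := by
      refine Finset.card_image_le.trans ?_
      rw [← Set.ncard_eq_toFinset_card _ hfin]
      exact hcard.trans (Nat.mul_le_mul_left _ hHd)
    have h3 := Finset.card_union_le (toBivariate F).leadingCoeff.roots.toFinset
      (hfin.toFinset.image Prod.fst)
    nlinarith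
  · rcases hdom q with h | h <;> rw [h]
    exacts [isOpen_empty, isOpen_gap Δ q.1]
  · rcases hdom q with h | h <;> rw [h]
    exacts [Set.ordConnected_empty, ordConnected_gap Δ q.1]
  · exact (mem_fiber (hsp z)).1 (sheet_mem_fiber hz.2)
  · exact (hgap hz.1).2 _ (sheet_mem_fiber hz.2)
  · exact (hloc hz.1).2 q.2 hz.2

/-- The set `S` is the union of at most `N` of its preconnected subsets. -/
def IsPreconnectedUnion {α : Type*} [TopologicalSpace α] (S : Set α) (N : ℕ) : Prop :=
  ∃ 𝒰 : Finset (Set α), 𝒰.card ≤ N ∧ (∀ U ∈ 𝒰, IsPreconnected U ∧ U ⊆ S) ∧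
    ∀ x ∈ S, ∃ U ∈ 𝒰, x ∈ U

namespace IsPreconnectedUnion

variable {α β : Type*} [TopologicalSpace α] [TopologicalSpace β] {S : Set α} {N : ℕ}

lemma mono (h : IsPreconnectedUnion S N) {M : ℕ} (hM : N ≤ M) : IsPreconnectedUnion S M := by
  obtain ⟨𝒰, h1, h2⟩ := h
  exact ⟨𝒰, h1.trans hM, h2⟩

lemma of_finite (hS : S.Finite) : IsPreconnectedUnion S S.ncard := by
  classical
  refine ⟨hS.toFinset.image fun x => {x}, ?_, ?_, fun x hx => ⟨{x}, ?_, rfl⟩⟩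
  · rw [Set.ncard_eq_toFinset_card S hS]
    exact Finset.card_image_le
  · simp only [Finset.mem_image, Set.Finite.mem_toFinset]
    rintro _ ⟨x, hx, rfl⟩
    exact ⟨isPreconnected_singleton, Set.singleton_subset_iff.2 hx⟩
  · exact Finset.mem_image_of_mem _ (hS.mem_toFinset.2 hx)

lemma image (h : IsPreconnectedUnion S N) {f : α → β} (hf : Continuous f) :
    IsPreconnectedUnion (f '' S) N := by
  classical
  obtain ⟨𝒰, h1, h2, h3⟩ := h
  refine ⟨𝒰.image fun U => f '' U, Finset.card_image_le.trans h1, ?_, ?_⟩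
  · simp only [Finset.mem_image]
    rintro _ ⟨U, hU, rfl⟩
    exact ⟨(h2 U hU).1.image f hf.continuousOn, Set.image_mono (h2 U hU).2⟩
  · rintro _ ⟨x, hx, rfl⟩
    obtain ⟨U, hU, hxU⟩ := h3 x hx
    exact ⟨_, Finset.mem_image_of_mem _ hU, x, hxU, rfl⟩

lemma finite_connectedComponents (h : IsPreconnectedUnion S N) :
    Finite (ConnectedComponents S) ∧ Nat.card (ConnectedComponents S) ≤ N := by
  classical
  obtain ⟨𝒰, h1, h2, h3⟩ := h
  choose U hU hxU using h3
  have hne : ∀ c : ConnectedComponents S, ∃ V : 𝒰, (∃ x : S, (x : α) ∈ V.1) ∧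
      ∀ x : S, (x : α) ∈ V.1 → (x : ConnectedComponents S) = c := by
    intro c
    obtain ⟨x, rfl⟩ := ConnectedComponents.surjective_coe c
    refine ⟨⟨U x x.2, hU x x.2⟩, ⟨x, hxU x x.2⟩, fun y hy => ?_⟩
    rw [ConnectedComponents.coe_eq_coe']
    have h4 : IsPreconnected ((↑) ⁻¹' U x x.2 : Set S) := by
      rw [Topology.IsInducing.subtypeVal.isPreconnected_image.symm,
        Subtype.image_preimage_coe, Set.inter_eq_right.2 (h2 _ (hU x x.2)).2]
      exact (h2 _ (hU x x.2)).1
    exact h4.subset_connectedComponent (hxU x x.2) hy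
  choose V hV hV' using hne
  have hVinj : Function.Injective V := by
    intro a b hab
    obtain ⟨x, hx⟩ := hV a
    rw [← hV' a x hx, hV' b x (hab ▸ hx)]
  refine ⟨Finite.of_injective V hVinj, (Nat.card_le_card_of_injective V hVinj).trans ?_⟩
  simpa using h1

end IsPreconnectedUnion

lemma Set.sum_ncard_le_ncard {ι α β : Type*} {A : Finset ι} {s : ι → Set α} {f : ι → α → β}
    {Z : Set β} (hZ : Z.Finite) (hf : ∀ i ∈ A, ∀ x ∈ s i, f i x ∈ Z)
    (hinj : ∀ i ∈ A, ∀ x ∈ s i, ∀ j ∈ A, ∀ y ∈ s j, f i x = f j y → i = j ∧ x = y) :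
    ∑ i ∈ A, (s i).ncard ≤ Z.ncard := by
  classical
  have hfin : ∀ i ∈ A, (s i).Finite := fun i hi =>
    Set.Finite.of_finite_image (f := f i)
      (hZ.subset (by rintro _ ⟨x, hx, rfl⟩; exact hf i hi x hx))
      fun x hx y hy hxy => (hinj i hi x hx i hi y hy hxy).2
  have h1 : ∀ i : A, ((hfin i i.2).toFinset.image (f i)).card = (s i).ncard := fun i => by
    rw [Finset.card_image_of_injOn, Set.ncard_eq_toFinset_card _ (hfin i i.2)]
    intro x hx y hy hxy
    exact (hinj i i.2 x (by simpa using hx) i i.2 y (by simpa using hy) hxy).2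
  rw [← Finset.sum_coe_sort, ← Finset.sum_congr rfl fun i _ => h1 i, ← Finset.card_biUnion,
    Set.ncard_eq_toFinset_card _ hZ]
  · refine Finset.card_le_card fun z hz => ?_
    simp only [Finset.mem_biUnion, Finset.mem_image, Set.Finite.mem_toFinset] at hz ⊢
    obtain ⟨i, -, x, hx, rfl⟩ := hz
    exact hf i i.2 x hx
  · intro i _ j _ hij
    rw [Function.onFun, Finset.disjoint_left]
    simp only [Finset.mem_image, Set.Finite.mem_toFinset]
    rintro _ ⟨x, hx, rfl⟩ ⟨y, hy, hxy⟩
    exact hij (Subtype.ext (hinj j j.2 y hy i i.2 x hx hxy).1.symm)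

/-- The indices of the arcs of the curve. -/
def arcIndices (F : MvPolynomial (Fin 2) ℝ) (Δ : Finset ℝ) : Finset (ℕ × ℕ) :=
  Finset.range (Δ.card + 1) ×ˢ Finset.range F.totalDegree

/-- The points of the curve over `Δ`. -/
noncomputable def pointsOver (F : MvPolynomial (Fin 2) ℝ) (Δ : Finset ℝ) : Finset (ℝ × ℝ) :=
  (Δ.sigma fun x => fiber F x).image fun p => (p.1, p.2)

lemma card_pointsOver_le (F : MvPolynomial (Fin 2) ℝ) (Δ : Finset ℝ) :
    (pointsOver F Δ).card ≤ Δ.card * F.totalDegree := by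
  refine Finset.card_image_le.trans ?_
  rw [Finset.card_sigma]
  exact Finset.sum_le_card_nsmul _ _ _ fun x _ => card_fiber_le F x

lemma mem_pointsOver_or_exists_arcDomain {F : MvPolynomial (Fin 2) ℝ}
    (hsp : ∀ x, specialize F x ≠ 0) (Δ : Finset ℝ) {x y : ℝ} (h : eval ![x, y] F = 0) :
    (x, y) ∈ pointsOver F Δ ∨
      ∃ q ∈ arcIndices F Δ, x ∈ arcDomain F Δ q ∧ sheet F q.2 x = y := by
  have hy := (mem_fiber (hsp x)).2 h
  by_cases hx : x ∈ Δ
  · exact Or.inl (Finset.mem_image.2 ⟨⟨x, y⟩, Finset.mem_sigma.2 ⟨hx, hy⟩, rfl⟩)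
  · obtain ⟨k, hk, hxk⟩ := mem_gap hx
    obtain ⟨i, hi, hiy⟩ := exists_sheet_eq hy
    exact Or.inr ⟨(k, i), Finset.mem_product.2 ⟨hk, Finset.mem_range.2
      (hi.trans_le (card_fiber_le F x))⟩, ⟨hxk, hi⟩, hiy⟩

lemma eq_of_mem_arcDomain {F : MvPolynomial (Fin 2) ℝ} {Δ : Finset ℝ} {p q : ℕ × ℕ} {x y : ℝ}
    (hx : x ∈ arcDomain F Δ p) (hy : y ∈ arcDomain F Δ q)
    (h : (x, sheet F p.2 x) = (y, sheet F q.2 y)) : p = q ∧ x = y := by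
  obtain ⟨rfl, h2⟩ := Prod.mk.inj h
  exact ⟨Prod.ext (hx.1.2.symm.trans hy.1.2) (sheet_injOn F x hx.2 hy.2 h2), rfl⟩

lemma sum_ncard_zeros_le {F H : MvPolynomial (Fin 2) ℝ} (hF : Irreducible F) (hH : ¬ F ∣ H)
    {Δ : Finset ℝ} (hΔ : ∀ q, IsArc F (arcDomain F Δ q) (sheet F q.2)) :
    ∑ q ∈ arcIndices F Δ, {x ∈ arcDomain F Δ q | eval ![x, sheet F q.2 x] H = 0}.ncard ≤
      F.totalDegree * H.totalDegree := by
  obtain ⟨h1, h2⟩ := finite_common_zeros hF hH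
  refine le_trans (Set.sum_ncard_le_ncard (f := fun q x => (x, sheet F q.2 x)) h1 ?_ ?_) h2
  · exact fun q _ x hx => ⟨(hΔ q).eval_eq_zero x hx.1, hx.2⟩
  · exact fun p _ x hx q _ y hy h => eq_of_mem_arcDomain hx.1 hy.1 h

lemma card_arcIndices_le {F : MvPolynomial (Fin 2) ℝ} {Δ : Finset ℝ} (hd : 1 ≤ F.totalDegree)
    (hΔ : Δ.card ≤ 3 * F.totalDegree ^ 2) : (arcIndices F Δ).card ≤ 4 * F.totalDegree ^ 3 := by
  rw [arcIndices, Finset.card_product, Finset.card_range, Finset.card_range]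
  have : Δ.card + 1 ≤ 4 * F.totalDegree ^ 2 := by nlinarith
  calc _ ≤ 4 * F.totalDegree ^ 2 * F.totalDegree := Nat.mul_le_mul_right _ this
    _ = _ := by ring

lemma isPreconnectedUnion_curve {F : MvPolynomial (Fin 2) ℝ} (hF : Irreducible F)
    (hY : pderiv 1 F ≠ 0) (hX : ¬ F ∣ X 1) :
    IsPreconnectedUnion {p : ℝ × ℝ | eval ![p.1, p.2] F = 0} (7 * F.totalDegree ^ 3) := by
  classical
  obtain ⟨Δ, hΔ, harc⟩ := exists_isArc_arcDomain hF hY hX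
  have hsp := specialize_ne_zero hF hY
  have hd := one_le_totalDegree_of_pderiv_ne_zero hY
  refine ⟨(arcIndices F Δ).image (fun q => (fun x => (x, sheet F q.2 x)) '' arcDomain F Δ q) ∪
    (pointsOver F Δ).image (fun p => {p}), ?_, ?_, ?_⟩
  · refine (Finset.card_union_le _ _).trans ?_
    have h1 := card_arcIndices_le hd hΔ
    have h2 := card_pointsOver_le F Δ
    have h3 := Nat.mul_le_mul_right F.totalDegree hΔ
    have h4 : ((arcIndices F Δ).image
      (fun q => (fun x => (x, sheet F q.2 x)) '' arcDomain F Δ q)).card ≤ _ :=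
      Finset.card_image_le
    have h5 : ((pointsOver F Δ).image (fun p => ({p} : Set (ℝ × ℝ)))).card ≤ _ :=
      Finset.card_image_le
    nlinarith
  · intro U hU
    rcases Finset.mem_union.1 hU with hU | hU
    · obtain ⟨q, hq, rfl⟩ := Finset.mem_image.1 hU
      refine ⟨(harc q).ordConnected.isPreconnected.image _ ?_, ?_⟩
      · exact continuousOn_id.prodMk fun x hx =>
          ((harc q).hasDerivAt x hx).continuousAt.continuousWithinAt
      · rintro _ ⟨x, hx, rfl⟩
        exact (harc q).eval_eq_zero x hx
    · obtain ⟨p, hp, rfl⟩ := Finset.mem_image.1 hU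
      refine ⟨isPreconnected_singleton, Set.singleton_subset_iff.2 ?_⟩
      obtain ⟨⟨x, y⟩, hxy, rfl⟩ := Finset.mem_image.1 hp
      exact (mem_fiber (hsp x)).1 (Finset.mem_sigma.1 hxy).2
  · rintro ⟨x, y⟩ hxy
    rcases mem_pointsOver_or_exists_arcDomain (x := x) (y := y) hsp Δ hxy with
      h | ⟨q, hq, hx, rfl⟩
    · exact ⟨_, Finset.mem_union_right _ (Finset.mem_image_of_mem _ h), rfl⟩
    · exact ⟨_, Finset.mem_union_left _ (Finset.mem_image_of_mem _ hq), x, hx, rfl⟩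

lemma exists_minimal_representative {σ K : Type*} [Field K] (F G : MvPolynomial σ K) :
    ∃ G' : MvPolynomial σ K, F ∣ G - G' ∧ G'.support.card ≤ G.support.card ∧
      ∀ B : MvPolynomial σ K, B.support ⊆ G'.support → F ∣ B → B = 0 := by
  classical
  obtain ⟨G', hG', hmin⟩ := (measure fun P : MvPolynomial σ K => P.support.card).wf.has_min
    {P | F ∣ G - P} ⟨G, by simp⟩
  refine ⟨G', hG', not_lt.1 (hmin G (by simp)), fun B hB hFB => ?_⟩
  by_contra hB0
  obtain ⟨m, hm⟩ := Finset.nonempty_of_ne_empty (mt support_eq_empty.1 hB0)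
  set c := coeff m G' / coeff m B
  refine hmin (G' - c • B) ?_ (Finset.card_lt_card (s := (G' - c • B).support)
    (t := G'.support) ?_)
  · have : G - (G' - c • B) = (G - G') + c • B := by ring
    rw [Set.mem_ofPred_eq, this, smul_eq_C_mul]
    exact dvd_add hG' (hFB.mul_left _)
  · rw [Finset.ssubset_iff_of_subset]
    · refine ⟨m, hB hm, ?_⟩
      rw [notMem_support_iff, coeff_sub, coeff_smul, smul_eq_mul,
        div_mul_cancel₀ _ (mem_support_iff.1 hm), sub_self]
    · intro n hn
      by_contra hn'
      have h1 := notMem_support_iff.1 hn'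
      have h2 := notMem_support_iff.1 fun h => hn' (hB h)
      exact mem_support_iff.1 hn (by rw [coeff_sub, coeff_smul, h1, h2, smul_zero, sub_zero])

lemma eval_monomial_ne_zero_of_eval_X {σ K : Type*} [Fintype σ] [Field K] {v : σ → K}
    (hv : ∀ i, v i ≠ 0) (e : σ →₀ ℕ) : eval v (monomial e 1) ≠ 0 := by
  rw [eval_monomial, one_mul, Finsupp.prod, Finset.prod_ne_zero_iff]
  exact fun i _ => pow_ne_zero _ (hv i)

theorem ncard_common_zeros_le {F G : MvPolynomial (Fin 2) ℝ} (hF : Irreducible F)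
    (hY : pderiv 1 F ≠ 0) (hX : ¬ F ∣ X 1) (hFG : ¬ F ∣ G) :
    {p : ℝ × ℝ | eval ![p.1, p.2] F = 0 ∧ eval ![p.1, p.2] G = 0}.ncard ≤
      7 * F.totalDegree ^ 3 * G.support.card + 3 * F.totalDegree ^ 2 * G.support.card ^ 3 := by
  classical
  obtain ⟨Δ, hΔ, harc⟩ := exists_isArc_arcDomain hF hY hX
  have hsp := specialize_ne_zero hF hY
  have hd := one_le_totalDegree_of_pderiv_ne_zero hY
  obtain ⟨G', hGG', hcard, hmin⟩ := exists_minimal_representative F G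
  have hFG' : ¬ F ∣ G' := fun h => hFG (by simpa using dvd_add hGG' h)
  have hG'0 : G' ≠ 0 := fun h => hFG' (h ▸ dvd_zero F)
  obtain ⟨T, hT⟩ : ∃ T, G'.support.card = T + 1 :=
    Nat.exists_eq_succ_of_ne_zero (by simpa using hG'0)
  set ε := (Finset.equivFinOfCardEq hT).symm
  set e : ℕ → Fin 2 →₀ ℕ := fun j => if h : j < T + 1 then ε ⟨j, h⟩ else 0
  set c : ℕ → ℝ := fun j => coeff (e j) G'
  set g : ℕ → MvPolynomial (Fin 2) ℝ := fun j => monomial (e j) 1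
  have he_mem : ∀ j < T + 1, e j ∈ G'.support := fun j hj => by
    simp only [e, dif_pos hj]
    exact (ε _).2
  have he_inj : ∀ i < T + 1, ∀ j < T + 1, e i = e j → i = j := by
    intro i hi j hj hij
    simp only [e, dif_pos hi, dif_pos hj] at hij
    simpa using ε.injective (Subtype.ext hij)
  have hsum : ∑ j ∈ Finset.range (T + 1), c j • g j = G' := by
    conv_rhs => rw [G'.as_sum]
    refine Finset.sum_bij (fun j _ => e j) (fun j hj => he_mem j (Finset.mem_range.1 hj))
      (fun i hi j hj h => he_inj i (Finset.mem_range.1 hi) j (Finset.mem_range.1 hj) h) ?_ ?_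
    · intro m hm
      refine ⟨ε.symm ⟨m, hm⟩, Finset.mem_range.2 (ε.symm ⟨m, hm⟩).2, ?_⟩
      simp only [e]
      rw [dif_pos (Fin.is_lt _)]
      simp
    · intro j _
      simp [g, c, smul_monomial]
  have hg : ∀ k < T + 1, ∀ b : ℕ → ℝ, ¬ F ∣ g k - ∑ j ∈ Finset.range k, b j • g j := by
    intro k hk b hdvd
    have hcoeff : ∀ m, coeff m (g k - ∑ j ∈ Finset.range k, b j • g j) =
        (if e k = m then 1 else 0) - ∑ j ∈ Finset.range k, b j * if e j = m then 1 else 0 := by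
      intro m
      simp [g, coeff_sub, coeff_sum, coeff_monomial]
    have h0 := hmin _ (fun m hm => ?_) hdvd
    · have h1 := hcoeff (e k)
      rw [h0, coeff_zero, if_pos rfl, Finset.sum_eq_zero, sub_zero] at h1
      · exact zero_ne_one h1
      · intro j hj
        rw [Finset.mem_range] at hj
        rw [if_neg fun h => hj.ne (he_inj j (hj.trans hk) k hk h), mul_zero]
    · by_contra hm'
      have h2 : ∀ j < T + 1, e j ≠ m := fun j hj h => hm' (h ▸ he_mem j hj)
      refine mem_support_iff.1 hm ?_
      rw [hcoeff, if_neg (h2 k hk), Finset.sum_eq_zero, sub_zero]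
      intro j hj
      rw [if_neg (h2 j ((Finset.mem_range.1 hj).trans hk)), mul_zero]
  have hW : ∀ q, (arcDomain F Δ q).Nonempty → ∀ k ≤ T + 1,
      ¬ F ∣ (tangentDeriv F).wronskian g k := fun q hq k hk =>
    (harc q).not_dvd_wronskian hq hF g (T + 1) hg k hk
  have hWsum : ∀ k ≤ T + 1, ∑ q ∈ arcIndices F Δ, {x ∈ arcDomain F Δ q |
      eval ![x, sheet F q.2 x] ((tangentDeriv F).wronskian g k) = 0}.ncard ≤
      F.totalDegree ^ 2 * (T + 1) ^ 2 := by
    intro k hk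
    obtain ⟨H, hH, hWH⟩ := exists_wronskian_monomial F hd e k
    by_cases hne : ∃ q, (arcDomain F Δ q).Nonempty
    · obtain ⟨q₀, hq₀⟩ := hne
      have hFH : ¬ F ∣ H := fun h => hW q₀ hq₀ k hk (by
        rw [hWH]
        exact h.mul_left _)
      calc _ = ∑ q ∈ arcIndices F Δ,
            {x ∈ arcDomain F Δ q | eval ![x, sheet F q.2 x] H = 0}.ncard := by
            refine Finset.sum_congr rfl fun q _ => congrArg Set.ncard (Set.ext fun x => ?_)
            refine and_congr_right fun hx => ?_
            have h1 := (harc q).eval_ne_zero x hx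
            simp only [map_mul, eval_X, mul_ne_zero_iff] at h1
            rw [hWH, map_mul, map_prod, mul_eq_zero, or_iff_right]
            rw [Finset.prod_eq_zero_iff]
            rintro ⟨j, -, hj⟩
            refine eval_monomial_ne_zero_of_eval_X (fun i => ?_) _ hj
            fin_cases i
            exacts [h1.1.1, h1.1.2]
        _ ≤ F.totalDegree * H.totalDegree := sum_ncard_zeros_le hF hFH harc
        _ ≤ F.totalDegree * ((T + 1) ^ 2 * F.totalDegree) :=
            Nat.mul_le_mul_left _ (hH.trans (Nat.mul_le_mul_right _ (Nat.pow_le_pow_left hk 2)))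
        _ = _ := by ring
    · rw [Finset.sum_eq_zero]
      · exact Nat.zero_le _
      · intro q _
        rw [show {x ∈ arcDomain F Δ q | _} = ∅ from
          Set.eq_empty_of_forall_notMem fun x hx => hne ⟨q, x, hx.1⟩, Set.ncard_empty]
  set s : ℕ × ℕ → Set ℝ := fun q => {x ∈ arcDomain F Δ q | eval ![x, sheet F q.2 x] G' = 0}
  have hs : ∀ q, (s q).Finite ∧ (s q).ncard ≤ T + 3 * ∑ k ∈ Finset.Ico 1 (T + 2),
      {x ∈ arcDomain F Δ q |
        eval ![x, sheet F q.2 x] ((tangentDeriv F).wronskian g k) = 0}.ncard := by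
    intro q
    rcases (arcDomain F Δ q).eq_empty_or_nonempty with hq | hq
    · have : s q = ∅ := Set.eq_empty_of_forall_notMem fun x hx => by
        have := hx.1
        rw [hq] at this
        exact this
      rw [this, Set.ncard_empty]
      exact ⟨Set.finite_empty, Nat.zero_le _⟩
    · have h1 := (harc q).ncard_zeros_sum_le hF g T (hW q hq) c
        (mem_support_iff.1 (he_mem T (Nat.lt_succ_self T)))
      rwa [hsum] at h1
  have hsub : {p : ℝ × ℝ | eval ![p.1, p.2] F = 0 ∧ eval ![p.1, p.2] G = 0} ⊆
      ((pointsOver F Δ ∪ (arcIndices F Δ).biUnion fun q =>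
        (hs q).1.toFinset.image fun x => (x, sheet F q.2 x) : Finset (ℝ × ℝ)) :
        Set (ℝ × ℝ)) := by
    rintro ⟨x, y⟩ ⟨hx, hy⟩
    rw [Finset.mem_coe, Finset.mem_union]
    refine (mem_pointsOver_or_exists_arcDomain (x := x) (y := y) hsp Δ hx).imp_right ?_
    rintro ⟨q, hq, hxq, rfl⟩
    refine Finset.mem_biUnion.2 ⟨q, hq, Finset.mem_image.2 ⟨x, ?_, rfl⟩⟩
    rw [Set.Finite.mem_toFinset]
    refine ⟨hxq, ?_⟩
    obtain ⟨Q, hQ⟩ := hGG'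
    have h1 := congrArg (eval ![x, sheet F q.2 x]) hQ
    simp only [map_sub, map_mul] at h1 hx hy
    rw [hx, hy] at h1
    linarith
  have h1 := Set.ncard_le_ncard hsub (Finset.finite_toSet _)
  rw [Set.ncard_coe_finset] at h1
  have h2 := h1.trans (Finset.card_union_le _ _)
  have h3 := card_pointsOver_le F Δ
  have h4 : ((arcIndices F Δ).biUnion fun q =>
      (hs q).1.toFinset.image fun x => (x, sheet F q.2 x)).card ≤
      4 * F.totalDegree ^ 3 * T + 3 * ((T + 1) * (F.totalDegree ^ 2 * (T + 1) ^ 2)) := by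
    calc _ ≤ ∑ q ∈ arcIndices F Δ, (s q).ncard := by
          refine Finset.card_biUnion_le.trans (Finset.sum_le_sum fun q _ => ?_)
          exact Finset.card_image_le.trans (Set.ncard_eq_toFinset_card _ (hs q).1).ge
      _ ≤ ∑ q ∈ arcIndices F Δ, (T + 3 * ∑ k ∈ Finset.Ico 1 (T + 2), {x ∈ arcDomain F Δ q |
          eval ![x, sheet F q.2 x] ((tangentDeriv F).wronskian g k) = 0}.ncard) :=
          Finset.sum_le_sum fun q _ => (hs q).2
      _ = (arcIndices F Δ).card * T + 3 * ∑ k ∈ Finset.Ico 1 (T + 2),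
          ∑ q ∈ arcIndices F Δ, {x ∈ arcDomain F Δ q |
          eval ![x, sheet F q.2 x] ((tangentDeriv F).wronskian g k) = 0}.ncard := by
          rw [Finset.sum_add_distrib, Finset.sum_const, smul_eq_mul, ← Finset.mul_sum,
            Finset.sum_comm]
      _ ≤ _ := by
          refine Nat.add_le_add (Nat.mul_le_mul_right _ (card_arcIndices_le hd hΔ))
            (Nat.mul_le_mul_left _ ?_)
          refine (Finset.sum_le_card_nsmul _ _ _ fun k hk =>
            hWsum k (by have := Finset.mem_Ico.1 hk; omega)).trans ?_
          simp
  rw [hT] at hcard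
  have h5 := Nat.mul_le_mul_right F.totalDegree hΔ
  calc _ ≤ 7 * F.totalDegree ^ 3 * (T + 1) + 3 * F.totalDegree ^ 2 * (T + 1) ^ 3 := by nlinarith
    _ ≤ _ := by gcongr

lemma irreducible_of_irreducible_map {σ K L : Type*} [Field K] [Field L] (f : K →+* L)
    {F : MvPolynomial σ K} (hF : Irreducible (F.map f)) : Irreducible F := by
  have : IsLocalHom (MvPolynomial.map (σ := σ) f) := ⟨fun P hP => by
    rw [MvPolynomial.isUnit_iff] at hP ⊢
    simp only [coeff_map, isNilpotent_iff_eq_zero, isUnit_iff_ne_zero, ne_eq, map_eq_zero] at hP ⊢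
    exact hP⟩
  exact Irreducible.of_map (f := MvPolynomial.map (σ := σ) f) hF

lemma exists_pderiv_ne_zero {σ R : Type*} [CommRing R] [IsDomain R] [CharZero R]
    {F : MvPolynomial σ R} (hF : 1 ≤ F.totalDegree) : ∃ i, pderiv i F ≠ 0 := by
  classical
  by_contra! h
  have : F.totalDegree = 0 := by
    rw [totalDegree_eq_zero_iff]
    intro m hm i
    by_contra hi
    have h1 := coeff_pderiv (i := i) F (m - Finsupp.single i 1)
    rw [h i, coeff_zero, tsub_add_cancel_of_le
      (Finsupp.single_le_iff.2 (Nat.one_le_iff_ne_zero.2 hi)), eq_comm, mul_eq_zero] at h1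
    exact h1.elim (mem_support_iff.1 hm) (Nat.cast_add_one_ne_zero _)
  omega

/-- The set of real common zeros. -/
def commonZeros (F G : MvPolynomial (Fin 2) ℝ) : Set (ℝ × ℝ) :=
  {p | eval ![p.1, p.2] F = 0 ∧ eval ![p.1, p.2] G = 0}

lemma isPreconnectedUnion_commonZeros_of_not_dvd_X {F G : MvPolynomial (Fin 2) ℝ} {t : ℕ}
    (hF : Irreducible F) (hY : pderiv 1 F ≠ 0) (hX : ¬ F ∣ X 1) (hG : G.support.card ≤ t)
    (ht : 1 ≤ t) : IsPreconnectedUnion (commonZeros F G)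
      (7 * (F.totalDegree ^ 3 * t + F.totalDegree ^ 2 * t ^ 3)) := by
  by_cases hFG : F ∣ G
  · have : commonZeros F G = {p : ℝ × ℝ | eval ![p.1, p.2] F = 0} := by
      obtain ⟨Q, rfl⟩ := hFG
      ext p
      simp +contextual [commonZeros]
    rw [this]
    refine (isPreconnectedUnion_curve hF hY hX).mono (Nat.mul_le_mul_left _ ?_)
    exact (Nat.le_mul_of_pos_right _ ht).trans (Nat.le_add_right _ _)
  · refine (IsPreconnectedUnion.of_finite (finite_common_zeros hF hFG).1).mono
      ((ncard_common_zeros_le hF hY hX hFG).trans ?_)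
    calc _ ≤ 7 * F.totalDegree ^ 3 * t + 3 * F.totalDegree ^ 2 * t ^ 3 := by gcongr
      _ ≤ _ := by nlinarith [Nat.zero_le (F.totalDegree ^ 2 * t ^ 3)]

lemma irreducible_X_sub_one : Irreducible (X 1 - C 1 : MvPolynomial (Fin 2) ℝ) := by
  classical
  have hcoeff : coeff (Finsupp.single 1 1) (X 1 - C 1 : MvPolynomial (Fin 2) ℝ) = 1 := by
    have h : (0 : Fin 2 →₀ ℕ) ≠ Finsupp.single 1 1 := fun h => by
      simpa using DFunLike.congr_fun h 1
    rw [coeff_sub, coeff_X, coeff_C, if_neg h, sub_zero, if_pos rfl]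
  refine irreducible_of_totalDegree_eq_one (le_antisymm ?_ ?_) fun x hx =>
    isUnit_of_dvd_one (hcoeff ▸ hx _)
  · exact (totalDegree_sub_C_le _ _).trans (totalDegree_X (R := ℝ) (1 : Fin 2)).le
  · refine one_le_totalDegree_of_pderiv_ne_zero (i := 1) ?_
    simp

lemma isPreconnectedUnion_commonZeros_of_pderiv_ne_zero {F G : MvPolynomial (Fin 2) ℝ} {t : ℕ}
    (hF : Irreducible F) (hY : pderiv 1 F ≠ 0) (hG : G.support.card ≤ t)
    (ht : 1 ≤ t) : IsPreconnectedUnion (commonZeros F G)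
      (7 * (F.totalDegree ^ 3 * t + F.totalDegree ^ 2 * t ^ 3)) := by
  classical
  by_cases hX : F ∣ X 1
  · have hd := one_le_totalDegree_of_pderiv_ne_zero hY
    have hzero : ∀ x y : ℝ, eval ![x, y] F = 0 ↔ y = 0 := by
      obtain ⟨q, hq⟩ := hX
      have hq0 : q ≠ 0 := by
        rintro rfl
        exact X_ne_zero _ (hq.trans (mul_zero F))
      have h1 := congrArg totalDegree hq
      rw [totalDegree_X, totalDegree_mul_of_isDomain hF.ne_zero hq0] at h1
      rw [totalDegree_eq_zero_iff_eq_C.1 (show q.totalDegree = 0 by omega)] at hq hq0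
      intro x y
      have h2 := congrArg (eval ![x, y]) hq
      rw [map_mul, eval_C, eval_X, Matrix.cons_val_one, Matrix.cons_val_zero] at h2
      have hc : coeff 0 q ≠ 0 := fun h => hq0 (by rw [h, C_0])
      exact ⟨fun h => by rw [h2, h, zero_mul],
        fun h => (mul_eq_zero.1 (h2.symm.trans h)).resolve_right hc⟩
    set F' : MvPolynomial (Fin 2) ℝ := X 1 - C 1
    set G' : MvPolynomial (Fin 2) ℝ := ∑ m ∈ G.support with m 1 = 0, monomial m (coeff m G)
    have hG' : G'.support.card ≤ t := by
      refine le_trans (Finset.card_le_card (t := G.support) ?_) hG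
      refine (support_sum).trans (Finset.biUnion_subset.2 fun m hm => ?_)
      exact support_monomial_subset.trans
        (Finset.singleton_subset_iff.2 (Finset.mem_filter.1 hm).1)
    have hGG' : ∀ x, eval ![x, 1] G' = eval ![x, 0] G := by
      intro x
      rw [eval_eq' _ G, map_sum, Finset.sum_filter]
      refine Finset.sum_congr rfl fun m _ => ?_
      split_ifs with h <;>
        simp [Fin.prod_univ_two, h, eval_monomial, Finsupp.prod_fintype]
    have hS : commonZeros F G = (fun p : ℝ × ℝ => (p.1, p.2 - 1)) '' commonZeros F' G' := by
      ext ⟨x, y⟩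
      simp only [commonZeros, Set.mem_image, Set.mem_ofPred_eq, hzero, Prod.mk.injEq]
      constructor
      · rintro ⟨rfl, h⟩
        exact ⟨(x, 1), ⟨by simp [F'], (hGG' x).trans h⟩, rfl, sub_self 1⟩
      · rintro ⟨⟨a, b⟩, ⟨h1, h2⟩, rfl, rfl⟩
        have hb : b = 1 := by simpa [F', sub_eq_zero] using h1
        subst hb
        refine ⟨sub_self 1, ?_⟩
        rw [sub_self, ← hGG', h2]
    have hF'd : F'.totalDegree ≤ 1 :=
      (totalDegree_sub_C_le _ _).trans (totalDegree_X (R := ℝ) (1 : Fin 2)).le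
    have hF' := isPreconnectedUnion_commonZeros_of_not_dvd_X (F := F') irreducible_X_sub_one
      (by simp [F']) (by
        rintro ⟨q, hq⟩
        simpa [F'] using congrArg (eval ![0, 1]) hq) hG' ht
    rw [hS]
    refine (hF'.image (by fun_prop)).mono ?_
    have := hF'd.trans hd
    gcongr
  · exact isPreconnectedUnion_commonZeros_of_not_dvd_X hF hY hX hG ht

lemma isPreconnectedUnion_commonZeros {F G : MvPolynomial (Fin 2) ℝ} {t : ℕ}
    (hF : Irreducible F) (hd : 1 ≤ F.totalDegree) (hG : G.support.card ≤ t)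
    (ht : 1 ≤ t) : IsPreconnectedUnion (commonZeros F G)
      (7 * (F.totalDegree ^ 3 * t + F.totalDegree ^ 2 * t ^ 3)) := by
  classical
  by_cases hY : pderiv 1 F = 0
  · obtain ⟨i, hi⟩ := exists_pderiv_ne_zero hd
    have hX : pderiv 0 F ≠ 0 := by
      fin_cases i
      exacts [hi, absurd hY hi]
    set τ : Equiv.Perm (Fin 2) := Equiv.swap 0 1
    have hF' : Irreducible (rename τ F) :=
      (MulEquiv.irreducible_iff (renameEquiv ℝ τ)).2 hF
    have hd' : (rename τ F).totalDegree = F.totalDegree := totalDegree_renameEquiv τ F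
    have hY' : pderiv 1 (rename τ F) ≠ 0 := by
      have h1 := pderiv_rename τ.injective 0 F
      rw [Equiv.swap_apply_left] at h1
      rw [h1]
      exact (map_ne_zero_iff _ (rename_injective _ τ.injective)).2 hX
    have hG' : (rename τ G).support.card ≤ t := by
      rw [support_rename_of_injective τ.injective]
      exact Finset.card_image_le.trans hG
    have h1 := isPreconnectedUnion_commonZeros_of_pderiv_ne_zero hF' hY' hG' ht
    have hS : commonZeros F G = Prod.swap '' commonZeros (rename τ F) (rename τ G) := by
      have hv : ∀ x y : ℝ, ![y, x] ∘ τ = ![x, y] := fun x y => by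
        ext i
        fin_cases i <;> simp [τ]
      rw [Set.image_swap_eq_preimage_swap]
      ext ⟨x, y⟩
      simp [commonZeros, eval_rename, hv]
    rw [hS, ← hd']
    exact h1.image continuous_swap
  · exact isPreconnectedUnion_commonZeros_of_pderiv_ne_zero hF hY hG ht

/-- If `F ∈ ℝ[X,Y]` is nonzero of total degree `d ≥ 1`, irreducible in `ℂ[X,Y]`, and
`G ∈ ℝ[X,Y]` is `t`-sparse (`t ≥ 1`), then the set of real solutions of
`F(x,y) = G(x,y) = 0` has at most `C · (d³t + d²t³)` connected components,
for an absolute constant `C > 0`. -/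
theorem sparse_irreducible_low_degree_connected_components :
    ∃ C : ℝ, 0 < C ∧
      ∀ (F G : MvPolynomial (Fin 2) ℝ) (d t : ℕ),
        F ≠ 0 → F.totalDegree = d → 1 ≤ d →
        Irreducible (F.map (algebraMap ℝ ℂ)) →
        G.support.card ≤ t → 1 ≤ t →
        ∀ S : Set (ℝ × ℝ),
          S = {p : ℝ × ℝ | eval ![p.1, p.2] F = 0 ∧ eval ![p.1, p.2] G = 0} →
          Finite (ConnectedComponents S) ∧
            (Nat.card (ConnectedComponents S) : ℝ) ≤
              C * ((d : ℝ) ^ 3 * t + (d : ℝ) ^ 2 * (t : ℝ) ^ 3) := by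
  refine ⟨7, by norm_num, ?_⟩
  rintro F G _ t - rfl hd hF hG ht _ rfl
  obtain ⟨h1, h2⟩ := (isPreconnectedUnion_commonZeros (irreducible_of_irreducible_map _ hF) hd hG
    ht).finite_connectedComponents
  exact ⟨h1, by exact_mod_cast h2⟩
end

section
/- Let g ∈ ℝ[X,Y] be a nonzero bivariate polynomial of total degree d. Then there exist a finite set P ⊆ ℝ² of cardinality at most d²/4 and finitely many polynomials g₁, …, g_k ∈ ℝ[X,Y], each dividing g in ℝ[X,Y] and each irreducible in ℂ[X,Y], such that the set of real zeros of g equals P ∪ ⋃_{i=1}^{k} {(x,y) ∈ ℝ² : g_i(x,y) = 0}. -/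
open MvPolynomial

/-- Bivariate polynomials of total degree at most `m` form a space of dimension
`(m + 1) (m + 2) / 2`. -/
lemma two_mul_finrank_restrictTotalDegree_fin_two (K : Type*) [Field K] (m : ℕ) :
    2 * Module.finrank K (restrictTotalDegree (Fin 2) K m) = (m + 1) * (m + 2) := by
  have hcard : Module.finrank K (restrictTotalDegree (Fin 2) K m)
      = Nat.card {n : Fin 2 →₀ ℕ | (n.sum fun _ e => e) ≤ m} :=
    Module.finrank_eq_nat_card_basis (basisRestrictSupport K _)
  have hsum (n : Fin 2 →₀ ℕ) : (n.sum fun _ e => e) = n 0 + n 1 := by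
    rw [Finsupp.sum_fintype _ _ (by simp), Fin.sum_univ_two]
  let e : {n : Fin 2 →₀ ℕ | (n.sum fun _ e => e) ≤ m} ≃
      (Finset.range (m + 1)).sigma (fun i => Finset.range (i + 1)) :=
    { toFun := fun n => ⟨⟨n.1 0 + n.1 1, n.1 0⟩, by
        have h := n.2
        rw [Set.mem_ofPred_eq, hsum] at h
        simp only [Finset.mem_sigma, Finset.mem_range]
        omega⟩
      invFun := fun x => ⟨Finsupp.equivFunOnFinite.symm ![x.1.2, x.1.1 - x.1.2], by
        have h := x.2
        simp only [Finset.mem_sigma, Finset.mem_range] at h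
        simp only [Set.mem_ofPred_eq, hsum,
          Finsupp.equivFunOnFinite_symm_apply_apply, Matrix.cons_val_zero, Matrix.cons_val_one]
        omega⟩
      left_inv := fun n => by
        ext i
        fin_cases i <;> simp
      right_inv := fun x => by
        have h := x.2
        simp only [Finset.mem_sigma, Finset.mem_range] at h
        ext <;> simp
        omega }
  rw [hcard, Nat.card_congr e, Nat.card_eq_fintype_card, Fintype.card_coe, Finset.card_sigma]
  simp only [Finset.card_range]
  have := Finset.sum_range_id_mul_two (m + 2)
  rw [Finset.sum_range_succ'] at this
  simp only [add_zero] at this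
  rw [mul_comm, this]
  simp [mul_comm]

/-- Some product of lines passes through all points of `S` other than `p`, but not through `p`. -/
lemma exists_eval_ne_zero_forall_eval_eq_zero {K : Type*} [Field K] (S : Finset (Fin 2 → K))
    (p : Fin 2 → K) :
    ∃ f : MvPolynomial (Fin 2) K, f.totalDegree ≤ S.card ∧ eval p f ≠ 0 ∧
      ∀ q ∈ S, q ≠ p → eval q f = 0 := by
  classical
  induction S using Finset.induction_on with
  | empty => exact ⟨1, by simp⟩
  | insert q S hq ih =>
    obtain ⟨f, hdeg, hp, hS⟩ := ih
    by_cases hqp : q = p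
    · refine ⟨f, hdeg.trans (Finset.card_le_card (Finset.subset_insert _ _)), hp, ?_⟩
      intro r hr hrp
      rcases Finset.mem_insert.1 hr with rfl | hr
      · exact absurd hqp hrp
      · exact hS r hr hrp
    · obtain ⟨i, hi⟩ := Function.ne_iff.1 hqp
      refine ⟨f * (X i - C (q i)), ?_, ?_, ?_⟩
      · rw [Finset.card_insert_of_notMem hq]
        refine (totalDegree_mul _ _).trans (add_le_add hdeg ?_)
        exact (totalDegree_sub_C_le _ _).trans (totalDegree_X i).le
      · simpa [hp, sub_eq_zero] using fun h => hi h.symm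
      · intro r hr hrp
        rcases Finset.mem_insert.1 hr with rfl | hr
        · simp
        · simp [hS r hr hrp]

/-- Polynomials of degree at most `m` interpolate arbitrary values on at most `m` points. -/
lemma surjective_eval_restrictTotalDegree {K : Type*} [Field K] (S : Finset (Fin 2 → K))
    {m : ℕ} (hm : S.card ≤ m) :
    Function.Surjective ((LinearMap.pi fun p : S => (aeval p.1).toLinearMap :
      MvPolynomial (Fin 2) K →ₗ[K] (S → K)).domRestrict (restrictTotalDegree (Fin 2) K m)) := by
  classical
  choose f hdeg hne hzero using exists_eval_ne_zero_forall_eval_eq_zero S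
  intro y
  refine ⟨⟨∑ p : S, C (y p / eval p.1 (f p)) * f p, ?_⟩, ?_⟩
  · refine Submodule.sum_mem _ fun p _ => ?_
    rw [← smul_eq_C_mul]
    exact Submodule.smul_mem _ _ ((mem_restrictTotalDegree _ _ _).2 ((hdeg p).trans hm))
  · ext q
    simp only [LinearMap.domRestrict_apply, LinearMap.pi_apply, AlgHom.toLinearMap_apply,
      aeval_eq_eval, map_sum, map_mul, eval_C]
    rw [Finset.sum_eq_single q]
    · exact div_mul_cancel₀ _ (hne q)
    · intro p _ hp
      rw [hzero p q q.2 fun h => hp (Subtype.ext h.symm), mul_zero]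
    · simp

/-- Bézout's inequality for curves the second of which is cut out by a nonzero polynomial. -/
theorem card_common_zeros_le_of_ne_zero {K : Type*} [Field K] {f g : MvPolynomial (Fin 2) K}
    (hg : g ≠ 0) (hfg : IsRelPrime f g) (S : Finset (Fin 2 → K))
    (hS : ∀ p ∈ S, eval p f = 0 ∧ eval p g = 0) :
    S.card ≤ f.totalDegree * g.totalDegree := by
  set m := f.totalDegree with hm
  set n := g.totalDegree with hn
  set N := S.card with hN
  let V := fun k => restrictTotalDegree (Fin 2) K k
  have hmul : ∀ (h : MvPolynomial (Fin 2) K) (k l : ℕ), h.totalDegree + k ≤ l →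
      ∀ c ∈ V k, LinearMap.mulLeft K h c ∈ V l := by
    intro h k l hl c hc
    rw [mem_restrictTotalDegree] at hc ⊢
    exact (totalDegree_mul _ _).trans (by omega)
  let Φ : (V (n + N) × V (m + N)) →ₗ[K] V (m + n + N) :=
    ((LinearMap.mulLeft K f).restrict (hmul f (n + N) (m + n + N) (by omega))).coprod
      ((LinearMap.mulLeft K g).restrict (hmul g (m + N) (m + n + N) (by omega)))
  let Ψ : V N →ₗ[K] (V (n + N) × V (m + N)) :=
    ((LinearMap.mulLeft K g).restrict (hmul g N (n + N) (by omega))).prod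
      (-(LinearMap.mulLeft K f).restrict (hmul f N (m + N) (by omega)))
  let E : V (m + n + N) →ₗ[K] (S → K) :=
    (LinearMap.pi fun p : S => (aeval p.1).toLinearMap).domRestrict _
  have hE : Function.Surjective E := surjective_eval_restrictTotalDegree S (by omega)
  have hΦE : LinearMap.range Φ ≤ LinearMap.ker E := by
    rintro _ ⟨⟨a, b⟩, rfl⟩
    rw [LinearMap.mem_ker]
    ext p
    simp [Φ, E, (hS p p.2).1, (hS p p.2).2]
  have hΦΨ : LinearMap.ker Φ ≤ LinearMap.range Ψ := by
    rintro ⟨⟨a, ha⟩, ⟨b, hb⟩⟩ hab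
    have hab : f * a + g * b = 0 := by
      simpa [Φ, Subtype.ext_iff] using hab
    have hdvd : g ∣ f * a := ⟨-b, by linear_combination hab⟩
    obtain ⟨c, rfl⟩ := hfg.symm.dvd_of_dvd_mul_left hdvd
    have hbc : b = -(f * c) := mul_left_cancel₀ hg (by linear_combination hab)
    have hc : c ∈ V N := by
      rw [mem_restrictTotalDegree] at ha ⊢
      by_cases hc0 : c = 0
      · simp [hc0]
      · rw [totalDegree_mul_of_isDomain hg hc0] at ha
        omega
    exact ⟨⟨c, hc⟩, by ext1 <;> simp [Ψ, Subtype.ext_iff, hbc]⟩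
  have h1 := LinearMap.finrank_range_add_finrank_ker Φ
  have h2 := LinearMap.finrank_range_add_finrank_ker E
  have h3 := Submodule.finrank_mono hΦE
  have h4 := (Submodule.finrank_mono hΦΨ).trans (LinearMap.finrank_range_le Ψ)
  rw [LinearMap.range_eq_top.2 hE, finrank_top, Module.finrank_fintype_fun_eq_card,
    Fintype.card_coe] at h2
  rw [Module.finrank_prod] at h1
  have d0 := two_mul_finrank_restrictTotalDegree_fin_two K N
  have d1 := two_mul_finrank_restrictTotalDegree_fin_two K (n + N)
  have d2 := two_mul_finrank_restrictTotalDegree_fin_two K (m + N)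
  have d3 := two_mul_finrank_restrictTotalDegree_fin_two K (m + n + N)
  simp only [V] at *
  nlinarith

/-- **Bézout's inequality**: two coprime plane curves of degrees `m` and `n` have at most `m * n`
points in common. -/
theorem card_common_zeros_le_s6 {K : Type*} [Field K] {f g : MvPolynomial (Fin 2) K}
    (hfg : IsRelPrime f g) (S : Finset (Fin 2 → K))
    (hS : ∀ p ∈ S, eval p f = 0 ∧ eval p g = 0) :
    S.card ≤ f.totalDegree * g.totalDegree := by
  by_cases hg : g = 0
  · have hf : IsUnit f := isRelPrime_zero_right.1 (hg ▸ hfg)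
    have hempty : S = ∅ := Finset.eq_empty_iff_forall_notMem.2 fun p hp =>
      (hf.map (eval p)).ne_zero (hS p hp).1
    simp [hempty]
  · exact card_common_zeros_le_of_ne_zero hg hfg S hS

lemma totalDegree_map_eq_of_injective {σ R S : Type*} [CommSemiring R] [CommSemiring S]
    {φ : R →+* S} (hφ : Function.Injective φ) (p : MvPolynomial σ R) :
    (map φ p).totalDegree = p.totalDegree := by
  rw [totalDegree, totalDegree, support_map_of_injective p hφ]

lemma totalDegree_eq_of_associated {σ R : Type*} [CommRing R] [IsDomain R]
    {p q : MvPolynomial σ R} (h : Associated p q) : p.totalDegree = q.totalDegree := by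
  obtain ⟨w, rfl⟩ := h
  by_cases hp : p = 0
  · simp [hp]
  · rw [totalDegree_mul_of_isDomain hp w.ne_zero,
      (isUnit_iff_totalDegree_of_isReduced.1 w.isUnit).2, add_zero]

/-- Decomposition of a complex polynomial into real and imaginary parts. -/
lemma exists_map_add_I_mul_map {σ : Type*} (F : MvPolynomial σ ℂ) :
    ∃ u v : MvPolynomial σ ℝ, F = map (algebraMap ℝ ℂ) u + C Complex.I * map (algebraMap ℝ ℂ) v ∧
      u.totalDegree ≤ F.totalDegree ∧ v.totalDegree ≤ F.totalDegree := by
  classical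
  have hsum : ∀ r : ℂ → ℝ, r 0 = 0 → ∃ u : MvPolynomial σ ℝ,
      (∀ s, coeff s u = r (coeff s F)) ∧ u.totalDegree ≤ F.totalDegree := by
    intro r hr
    have hu : ∀ s, coeff s (∑ t ∈ F.support, monomial t (r (coeff t F))) = r (coeff s F) := by
      intro s
      simp only [coeff_sum, coeff_monomial, Finset.sum_ite_eq', mem_support_iff]
      split_ifs with h
      · rfl
      · rw [not_not.1 h, hr]
    refine ⟨_, hu, Finset.sup_mono fun s hs => ?_⟩
    rw [mem_support_iff, hu] at hs
    exact mem_support_iff.2 fun h => hs (by rw [h, hr])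
  obtain ⟨u, hu, hud⟩ := hsum Complex.re rfl
  obtain ⟨v, hv, hvd⟩ := hsum Complex.im rfl
  refine ⟨u, v, ?_, hud, hvd⟩
  ext s
  rw [coeff_add, coeff_C_mul, coeff_map, coeff_map, hu, hv, mul_comm]
  exact (Complex.re_add_im _).symm

/-- A real irreducible polynomial that factors over `ℂ` is, up to a constant, a sum of two coprime
squares. -/
lemma exists_associated_sq_add_sq {σ : Type*} {h : MvPolynomial σ ℝ} (hh : Irreducible h)
    (hC : ¬ Irreducible (h.map (algebraMap ℝ ℂ))) :
    ∃ u v : MvPolynomial σ ℝ, Associated (u ^ 2 + v ^ 2) h ∧ IsRelPrime u v ∧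
      2 * u.totalDegree ≤ h.totalDegree ∧ 2 * v.totalDegree ≤ h.totalDegree := by
  have hinj : Function.Injective (map (σ := σ) (algebraMap ℝ ℂ)) :=
    map_injective _ (algebraMap ℝ ℂ).injective
  have hI : (C Complex.I : MvPolynomial σ ℂ) ^ 2 = -1 := by
    rw [← C_pow, Complex.I_sq, C_neg, C_1]
  have hconj : ∀ w : MvPolynomial σ ℝ,
      map (starRingEnd ℂ) (map (algebraMap ℝ ℂ) w) = map (algebraMap ℝ ℂ) w := by
    intro w
    ext s
    simp [coeff_map]
  have hnorm : ∀ (u v : MvPolynomial σ ℝ) (F : MvPolynomial σ ℂ),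
      F = map (algebraMap ℝ ℂ) u + C Complex.I * map (algebraMap ℝ ℂ) v →
      map (algebraMap ℝ ℂ) (u ^ 2 + v ^ 2) = F * map (starRingEnd ℂ) F := by
    rintro u v F rfl
    simp only [map_add, map_mul, map_pow, hconj, map_C, Complex.conj_I, C_neg]
    linear_combination (map (algebraMap ℝ ℂ) v) ^ 2 * hI
  have hnonunit : ∀ (w : MvPolynomial σ ℝ) (F : MvPolynomial σ ℂ), ¬ IsUnit F →
      map (algebraMap ℝ ℂ) w = F * map (starRingEnd ℂ) F → ¬ IsUnit w := by
    intro w F hF hw hu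
    have := hu.map (map (algebraMap ℝ ℂ))
    rw [hw] at this
    exact hF (isUnit_of_mul_isUnit_left this)
  have hnu : ¬ IsUnit (h.map (algebraMap ℝ ℂ)) := by
    intro hu
    rw [isUnit_iff_totalDegree_of_isReduced, coeff_map,
      totalDegree_map_eq_of_injective (algebraMap ℝ ℂ).injective] at hu
    exact hh.not_isUnit (isUnit_iff_totalDegree_of_isReduced.2
      ⟨isUnit_of_map_unit (algebraMap ℝ ℂ) _ hu.1, hu.2⟩)
  obtain ⟨F, Q, hFQ, hF, hQ⟩ : ∃ F Q, h.map (algebraMap ℝ ℂ) = F * Q ∧ ¬ IsUnit F ∧ ¬ IsUnit Q := by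
    by_contra! hcon
    exact hC ⟨hnu, fun F Q hFQ => or_iff_not_imp_left.2 fun hF => hcon F Q hFQ hF⟩
  obtain ⟨u, v, huv, hu, hv⟩ := exists_map_add_I_mul_map F
  obtain ⟨a, b, hab, -, -⟩ := exists_map_add_I_mul_map Q
  have hF' := hnorm u v F huv
  have hQ' := hnorm a b Q hab
  have hsq : h ^ 2 = (u ^ 2 + v ^ 2) * (a ^ 2 + b ^ 2) := by
    apply hinj
    rw [map_mul, hF', hQ', map_pow, sq]
    nth_rw 2 [← hconj h]
    rw [hFQ, map_mul]
    ring
  have hassoc : Associated (u ^ 2 + v ^ 2) h := by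
    obtain ⟨i, hi, hA⟩ := (dvd_prime_pow hh.prime 2).1 (Dvd.intro _ hsq.symm)
    interval_cases i
    · rw [pow_zero, associated_one_iff_isUnit] at hA
      exact absurd hA (hnonunit _ F hF hF')
    · rwa [pow_one] at hA
    · obtain ⟨w, hw⟩ := hA
      have h0 : u ^ 2 + v ^ 2 ≠ 0 := by
        intro h0
        rw [h0, zero_mul] at hw
        exact pow_ne_zero 2 hh.ne_zero hw.symm
      have hw' : (w : MvPolynomial σ ℝ) = a ^ 2 + b ^ 2 := mul_left_cancel₀ h0 (hw.trans hsq)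
      exact absurd (hw' ▸ w.isUnit) (hnonunit _ Q hQ hQ')
  have hdeg : 2 * F.totalDegree = h.totalDegree := by
    have h0 : F * map (starRingEnd ℂ) F ≠ 0 := by
      rw [← hF', (map_ne_zero_iff _ hinj)]
      exact hassoc.ne_zero_iff.2 hh.ne_zero
    rw [← totalDegree_eq_of_associated hassoc,
      ← totalDegree_map_eq_of_injective (algebraMap ℝ ℂ).injective (u ^ 2 + v ^ 2), hF',
      totalDegree_mul_of_isDomain (left_ne_zero_of_mul h0) (right_ne_zero_of_mul h0),
      totalDegree_map_eq_of_injective (starRingEnd ℂ).injective, two_mul]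
  refine ⟨u, v, hassoc, ?_, by omega, by omega⟩
  intro w hwu hwv
  have hw : w * w ∣ h := by
    refine Dvd.dvd.trans ?_ hassoc.dvd
    rw [← sq]
    exact dvd_add (pow_dvd_pow_of_dvd hwu 2) (pow_dvd_pow_of_dvd hwv 2)
  exact hh.squarefree w hw

/-- A real irreducible polynomial of degree `d` that factors over `ℂ` has at most `d ^ 2 / 4`
real zeros. -/
lemma exists_finset_coe_eq_zeros {h : MvPolynomial (Fin 2) ℝ} (hh : Irreducible h)
    (hC : ¬ Irreducible (h.map (algebraMap ℝ ℂ))) :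
    ∃ P : Finset (ℝ × ℝ), 4 * P.card ≤ h.totalDegree ^ 2 ∧
      {p : ℝ × ℝ | eval ![p.1, p.2] h = 0} = ↑P := by
  classical
  obtain ⟨u, v, hassoc, huv, hu, hv⟩ := exists_associated_sq_add_sq hh hC
  have hzero (p : Fin 2 → ℝ) (hp : eval p h = 0) : eval p u = 0 ∧ eval p v = 0 := by
    have hsq : eval p u ^ 2 + eval p v ^ 2 = 0 := by
      rw [← map_pow, ← map_pow, ← map_add]
      exact zero_dvd_iff.1 (hp ▸ map_dvd (eval p) hassoc.symm.dvd)
    constructor <;> nlinarith [sq_nonneg (eval p u), sq_nonneg (eval p v)]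
  have hinj : Function.Injective fun p : ℝ × ℝ => ![p.1, p.2] := fun p q hpq =>
    Prod.ext (congrFun hpq 0) (congrFun hpq 1)
  have hcard (S : Finset (ℝ × ℝ)) (hS : ∀ p ∈ S, eval ![p.1, p.2] h = 0) :
      4 * S.card ≤ h.totalDegree ^ 2 := by
    have hbound := card_common_zeros_le_s6 huv (S.image fun p => ![p.1, p.2]) fun q hq => by
      obtain ⟨p, hp, rfl⟩ := Finset.mem_image.1 hq
      exact hzero _ (hS p hp)
    rw [Finset.card_image_of_injective _ hinj] at hbound
    nlinarith [Nat.mul_le_mul hu hv]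
  have hfin : {p : ℝ × ℝ | eval ![p.1, p.2] h = 0}.Finite := by
    by_contra hinf
    obtain ⟨S, hS, hS'⟩ := Set.Infinite.exists_subset_card_eq hinf (h.totalDegree ^ 2 + 1)
    have := hcard S fun p hp => hS hp
    omega
  exact ⟨hfin.toFinset, hcard _ fun p hp => by simpa using hp, hfin.coe_toFinset.symm⟩

/-- **Lemma 5.** Let `g ∈ ℝ[X,Y]` be nonzero of total degree `d`.  The set of real zeros
of `g` is the union of a set of at most `d²/4` points and of the zero sets of polynomials
`g₁, …, g_k ∈ ℝ[X,Y]` which divide `g` and are irreducible in `ℂ[X,Y]`. -/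
theorem zero_set_eq_points_union_irreducible_factors
    (g : MvPolynomial (Fin 2) ℝ) (hg : g ≠ 0) (d : ℕ) (hd : g.totalDegree = d) :
    ∃ (P : Finset (ℝ × ℝ)) (k : ℕ) (G : Fin k → MvPolynomial (Fin 2) ℝ),
      (P.card : ℝ) ≤ (d : ℝ) ^ 2 / 4 ∧
      (∀ i, G i ∣ g) ∧
      (∀ i, Irreducible ((G i).map (algebraMap ℝ ℂ))) ∧
      {p : ℝ × ℝ | eval ![p.1, p.2] g = 0} =
        ↑P ∪ ⋃ i, {p : ℝ × ℝ | eval ![p.1, p.2] (G i) = 0} := by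
  classical
  induction g using WfDvdMonoid.induction_on_irreducible generalizing d with
  | zero => exact absurd rfl hg
  | unit g hu =>
    refine ⟨∅, 0, Fin.elim0, by simp; positivity, fun i => i.elim0, fun i => i.elim0, ?_⟩
    ext p
    simpa using (hu.map (eval ![p.1, p.2])).ne_zero
  | mul g h hg0 hh ih =>
    obtain ⟨P, k, G, hP, hdvd, hirr, hz⟩ := ih hg0 _ rfl
    rw [totalDegree_mul_of_isDomain hh.ne_zero hg0] at hd
    have hunion : {p : ℝ × ℝ | eval ![p.1, p.2] (h * g) = 0} =
        {p | eval ![p.1, p.2] h = 0} ∪ {p | eval ![p.1, p.2] g = 0} := by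
      ext p
      simp
    have hd' : (h.totalDegree : ℝ) + g.totalDegree = d := by exact_mod_cast hd
    have hd0 := mul_nonneg (Nat.cast_nonneg (α := ℝ) h.totalDegree)
      (Nat.cast_nonneg (α := ℝ) g.totalDegree)
    by_cases hC : Irreducible (h.map (algebraMap ℝ ℂ))
    · refine ⟨P, k + 1, Fin.cons h G, ?_, ?_, ?_, ?_⟩
      · rw [← hd']
        nlinarith
      · exact Fin.cases (dvd_mul_right h g) fun i => (hdvd i).mul_left h
      · exact Fin.cases hC hirr
      · rw [hunion, hz]
        ext p
        simp only [Set.mem_union, Set.mem_iUnion, Fin.exists_fin_succ, Fin.cons_zero, Fin.cons_succ]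
        tauto
    · obtain ⟨Q, hQ, hQz⟩ := exists_finset_coe_eq_zeros hh hC
      refine ⟨Q ∪ P, k, G, ?_, fun i => (hdvd i).mul_left h, hirr, ?_⟩
      · have h1 : ((Q ∪ P).card : ℝ) ≤ Q.card + P.card := by
          exact_mod_cast Finset.card_union_le Q P
        have h2 : 4 * (Q.card : ℝ) ≤ (h.totalDegree : ℝ) ^ 2 := by exact_mod_cast hQ
        rw [← hd']
        nlinarith
      · rw [hunion, hz, hQz, Finset.coe_union, Set.union_assoc]
end

section
/- Let f, g ∈ ℝ[X,Y] be two nonzero bivariate polynomials of total degrees δ and d respectively, and let 𝒰 be an open subset of ℝ². If the set of solutions in 𝒰 of the system f(X,Y) = 0, g(X,Y) = 0 is finite, then its cardinality is at most d²/4 + d·δ. -/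
open MvPolynomial

namespace MvPolynomial

/-- Polynomials of degree at most `m` in two variables form a space of dimension
`(m + 1) * (m + 2) / 2`. -/
theorem two_mul_finrank_restrictTotalDegree (K : Type*) [Field K] (m : ℕ) :
    2 * Module.finrank K (restrictTotalDegree (Fin 2) K m) = (m + 1) * (m + 2) := by
  have hset : {n : Fin 2 →₀ ℕ | (n.sum fun _ e => e) ≤ m} =
      ((Finset.range (m + 1)).biUnion
        fun k => (Finset.univ : Finset (Fin 2)).finsuppAntidiag k : Finset (Fin 2 →₀ ℕ)) := by
    ext n
    simp [Finset.mem_finsuppAntidiag, Finsupp.sum_fintype]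
  have hcard : Module.finrank K (restrictTotalDegree (Fin 2) K m) =
      ∑ k ∈ Finset.range (m + 1), (k + 1) := by
    unfold restrictTotalDegree
    rw [Module.finrank_eq_nat_card_basis (basisRestrictSupport K _), hset,
      SetLike.coe_sort_coe, Nat.card_eq_fintype_card, Fintype.card_coe, Finset.card_biUnion]
    · refine Finset.sum_congr rfl fun k _ => ?_
      rw [Finset.card_finsuppAntidiag_nat_eq_choose, Finset.card_univ, Fintype.card_fin,
        show 2 + k - 1 = k + 1 by omega, Nat.choose_succ_self_right]
    · intro i _ j _ hij
      refine Finset.disjoint_left.2 fun n hi hj => hij ?_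
      rw [Finset.mem_finsuppAntidiag] at hi hj
      exact hi.1.symm.trans hj.1
  rw [hcard]
  clear hset hcard
  induction m with
  | zero => simp
  | succ m ih => rw [Finset.sum_range_succ, mul_add, ih]; ring

theorem exists_eval_eq_one_of_ne {σ K : Type*} [Field K] {x y : σ → K} (h : x ≠ y) :
    ∃ p : MvPolynomial σ K, eval x p = 1 ∧ eval y p = 0 := by
  obtain ⟨i, hi⟩ := Function.ne_iff.1 h
  refine ⟨C (x i - y i)⁻¹ * (X i - C (y i)), ?_, by simp⟩
  simp [inv_mul_cancel₀ (sub_ne_zero.2 hi)]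

/-- Lagrange interpolation at a finite set of points of affine space. -/
theorem exists_eval_eq_one_and_eval_eq_zero {σ K : Type*} [Field K] (S : Finset (σ → K))
    (x : σ → K) : ∃ p : MvPolynomial σ K, eval x p = 1 ∧ ∀ y ∈ S, y ≠ x → eval y p = 0 := by
  classical
  choose! p hp using fun (y : σ → K) (h : x ≠ y) => exists_eval_eq_one_of_ne h
  refine ⟨∏ y ∈ S.erase x, p y, ?_, fun y hy hyx => ?_⟩
  · rw [map_prod]
    exact Finset.prod_eq_one fun y hy => (hp y (Finset.ne_of_mem_erase hy).symm).1
  · rw [map_prod]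
    exact Finset.prod_eq_zero (Finset.mem_erase.2 ⟨hyx, hy⟩) (hp y hyx.symm).2

/-- Evaluation at finitely many points is already surjective on polynomials of bounded degree. -/
theorem exists_surjective_eval_restrictTotalDegree {σ K : Type*} [Field K]
    (S : Finset (σ → K)) : ∃ M : ℕ, ∀ n, M ≤ n → ∀ v : S → K,
      ∃ p ∈ restrictTotalDegree σ K n, ∀ x : S, eval x.1 p = v x := by
  classical
  choose p hp using exists_eval_eq_one_and_eval_eq_zero S
  refine ⟨S.sup fun x => (p x).totalDegree, fun n hn v =>
    ⟨∑ x : S, v x • p x.1, Submodule.sum_mem _ fun x _ => Submodule.smul_mem _ _ ?_,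
      fun x => ?_⟩⟩
  · rw [mem_restrictTotalDegree]
    exact (Finset.le_sup (f := fun x => (p x).totalDegree) x.2).trans hn
  · rw [map_sum, Finset.sum_eq_single x]
    · simp [smul_eval, (hp x.1).1]
    · intro y _ hy
      rw [smul_eval, (hp y.1).2 x.1 x.2 fun h => hy (Subtype.ext h.symm), mul_zero]
    · simp

/-- **Bézout's inequality** in the affine plane: the number of common zeros of two relatively
prime polynomials is at most the product of their degrees. -/
theorem card_le_totalDegree_mul_totalDegree {K : Type*} [Field K]
    {f g : MvPolynomial (Fin 2) K} (hf : f ≠ 0) (hg : g ≠ 0) (hfg : IsRelPrime f g)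
    (S : Finset (Fin 2 → K)) (hSf : ∀ x ∈ S, eval x f = 0) (hSg : ∀ x ∈ S, eval x g = 0) :
    S.card ≤ f.totalDegree * g.totalDegree := by
  obtain ⟨M, hM⟩ := exists_surjective_eval_restrictTotalDegree S
  set a := f.totalDegree with ha
  set b := g.totalDegree with hb
  let V : ℕ → Submodule K (MvPolynomial (Fin 2) K) := restrictTotalDegree (Fin 2) K
  have mem_V (n : ℕ) (p : MvPolynomial (Fin 2) K) : p ∈ V n ↔ p.totalDegree ≤ n :=
    mem_restrictTotalDegree _ _ _
  have finite_V (n : ℕ) : FiniteDimensional K (V n) :=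
    inferInstanceAs (Module.Finite K (restrictTotalDegree (Fin 2) K n))
  have finrank_V (n : ℕ) : 2 * Module.finrank K (V n) = (n + 1) * (n + 2) :=
    two_mul_finrank_restrictTotalDegree K n
  replace hM : ∀ n, M ≤ n → ∀ v : S → K, ∃ p ∈ V n, ∀ x : S, eval x.1 p = v x := hM
  clear_value V
  let A := (V (M + b)).map (LinearMap.mulLeft K f)
  let B := (V (M + a)).map (LinearMap.mulLeft K g)
  let D := (V M).map (LinearMap.mulLeft K (f * g))
  have finrank_map (h : MvPolynomial (Fin 2) K) (hh : h ≠ 0) (n : ℕ) :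
      Module.finrank K ((V n).map (LinearMap.mulLeft K h)) = Module.finrank K (V n) := by
    have hinj : Function.Injective (LinearMap.mulLeft K h) := mul_right_injective₀ hh
    exact (Submodule.equivMapOfInjective _ hinj (V n)).finrank_eq.symm
  have hAV : A ≤ V (M + a + b) := by
    rintro _ ⟨p, hp, rfl⟩
    have hp := (mem_V _ _).1 hp
    refine (mem_V _ _).2 ((totalDegree_mul f p).trans ?_)
    omega
  have hBV : B ≤ V (M + a + b) := by
    rintro _ ⟨p, hp, rfl⟩
    have hp := (mem_V _ _).1 hp
    refine (mem_V _ _).2 ((totalDegree_mul g p).trans ?_)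
    omega
  have hinf : A ⊓ B ≤ D := by
    rintro _ ⟨⟨p, hp, rfl⟩, ⟨q, -, hq⟩⟩
    rw [LinearMap.mulLeft_apply, LinearMap.mulLeft_apply] at hq
    obtain ⟨r, rfl⟩ := hfg.symm.dvd_of_dvd_mul_left ⟨q, hq.symm⟩
    refine ⟨r, (mem_V _ _).2 ?_, by simp⟩
    have hp := (mem_V _ _).1 hp
    rcases eq_or_ne r 0 with rfl | hr
    · simp
    · rw [totalDegree_mul_of_isDomain hg hr] at hp
      omega
  let E : MvPolynomial (Fin 2) K →ₗ[K] (S → K) :=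
    LinearMap.pi fun x : S => (aeval x.1 : MvPolynomial (Fin 2) K →ₐ[K] K).toLinearMap
  have E_apply (p : MvPolynomial (Fin 2) K) (x : S) : E p x = eval x.1 p := by
    simp [E, aeval_eq_eval]
  clear_value E
  have hE : LinearMap.range (E.domRestrict (V (M + a + b))) = ⊤ :=
    LinearMap.range_eq_top.2 fun v => by
      obtain ⟨p, hp, hpv⟩ := hM (M + a + b) (by omega) v
      refine ⟨⟨p, hp⟩, ?_⟩
      rw [LinearMap.domRestrict_apply]
      funext x
      rw [E_apply, hpv]
  have hker : (A ⊔ B).comap (V (M + a + b)).subtype ≤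
      LinearMap.ker (E.domRestrict (V (M + a + b))) := by
    rintro ⟨p, hpV⟩ hp
    obtain ⟨_, ⟨r, -, rfl⟩, _, ⟨s, -, rfl⟩, hrs⟩ := Submodule.mem_sup.1 (Submodule.mem_comap.1 hp)
    rw [LinearMap.mulLeft_apply, LinearMap.mulLeft_apply, Submodule.subtype_apply] at hrs
    rw [LinearMap.mem_ker, LinearMap.domRestrict_apply]
    funext x
    rw [E_apply, ← hrs]
    simp [hSf x.1 x.2, hSg x.1 x.2]
  have h1 := LinearMap.finrank_range_add_finrank_ker (E.domRestrict (V (M + a + b)))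
  rw [hE, finrank_top, Module.finrank_fintype_fun_eq_card, Fintype.card_coe] at h1
  have h2 := Submodule.finrank_mono hker
  rw [(Submodule.comapSubtypeEquivOfLe (sup_le hAV hBV)).finrank_eq] at h2
  have : FiniteDimensional K A := inferInstanceAs (FiniteDimensional K ((V _).map _))
  have : FiniteDimensional K B := inferInstanceAs (FiniteDimensional K ((V _).map _))
  have : FiniteDimensional K D := inferInstanceAs (FiniteDimensional K ((V _).map _))
  have h3 := Submodule.finrank_sup_add_finrank_inf_eq A B
  have h4 := Submodule.finrank_mono hinf
  rw [finrank_map f hf, finrank_map g hg] at h3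
  rw [finrank_map _ (mul_ne_zero hf hg)] at h4
  have e0 := finrank_V (M + a + b)
  have e1 := finrank_V (M + b)
  have e2 := finrank_V (M + a)
  have e3 := finrank_V M
  nlinarith

theorem totalDegree_pderiv_lt {σ R : Type*} [CommSemiring R] {p : MvPolynomial σ R} {i : σ}
    (h : pderiv i p ≠ 0) : (pderiv i p).totalDegree < p.totalDegree := by
  obtain ⟨m, hm, hmd⟩ := Finset.exists_mem_eq_sup (pderiv i p).support (by simpa using h)
    (fun m => m.sum fun _ e => e)
  have hm' : m + Finsupp.single i 1 ∈ p.support := by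
    rw [mem_support_iff, coeff_pderiv] at hm
    exact mem_support_iff.2 (left_ne_zero_of_mul hm)
  have := le_totalDegree hm'
  rw [Finsupp.sum_add_index' (by simp) (by simp), Finsupp.sum_single_index rfl] at this
  rw [totalDegree, hmd]
  omega

theorem exists_pderiv_ne_zero {σ R : Type*} [CommSemiring R] [NoZeroDivisors R] [CharZero R]
    {p : MvPolynomial σ R} (h : p.totalDegree ≠ 0) : ∃ i, pderiv i p ≠ 0 := by
  rw [ne_eq, totalDegree_eq_zero_iff] at h
  push Not at h
  obtain ⟨m, hm, i, hi⟩ := h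
  refine ⟨i, fun h0 => ?_⟩
  have hc := congrArg (coeff (m - Finsupp.single i 1)) h0
  have hle : Finsupp.single i 1 ≤ m := by
    rw [Finsupp.single_le_iff]; omega
  rw [coeff_pderiv, tsub_add_cancel_of_le hle, coeff_zero] at hc
  exact (mul_ne_zero (mem_support_iff.1 hm) (Nat.cast_add_one_ne_zero _)) (by simpa using hc)

theorem hasDerivAt_eval_update {σ : Type*} [DecidableEq σ] (p : MvPolynomial σ ℝ) (x : σ → ℝ)
    (i : σ) (t : ℝ) :
    HasDerivAt (fun s => eval (Function.update x i s) p)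
      (eval (Function.update x i t) (pderiv i p)) t := by
  induction p using MvPolynomial.induction_on with
  | C a => simpa using hasDerivAt_const t a
  | add p q hp hq =>
    simp only [map_add]
    exact hp.add hq
  | mul_X p j hp =>
    have hX : HasDerivAt (fun s => Function.update x i s j)
        (eval (Function.update x i t) (pderiv i (X j))) t := by
      rcases eq_or_ne j i with rfl | hj
      · simp only [Function.update_self, pderiv_X_self, map_one]
        exact hasDerivAt_id t
      · simp only [pderiv_X_of_ne hj, Function.update_of_ne hj, map_zero]
        exact hasDerivAt_const t (x j)
    simp only [map_mul, eval_X, pderiv_mul, map_add]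
    exact hp.mul hX

end MvPolynomial

open Filter Topology in
/-- A zero of a continuous function on the plane is not isolated if a partial derivative is
positive there. -/
theorem infinite_zeros_of_deriv_pos {F : ℝ × ℝ → ℝ} (hF : Continuous F) {U : Set (ℝ × ℝ)}
    (hU : IsOpen U) {a b : ℝ} (hab : (a, b) ∈ U) (h0 : F (a, b) = 0)
    (hd : 0 < deriv (fun t => F (t, b)) a) : {z | z ∈ U ∧ F z = 0}.Infinite := by
  obtain ⟨ε, hε, hball⟩ := Metric.isOpen_iff.1 hU _ hab
  have hsign := eventually_nhdsWithin_sign_eq_of_deriv_pos hd h0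
  obtain ⟨η, hη, hsign⟩ := Metric.eventually_nhds_iff.1 hsign
  set ρ := min ε η / 2 with hρ
  have hρ0 : 0 < ρ := by positivity
  have hρε : ρ < ε := by linarith [min_le_left ε η, lt_min hε hη]
  have hρη : ρ < η := by linarith [min_le_right ε η, lt_min hε hη]
  have hpos : 0 < F (a + ρ, b) := by
    have := hsign (y := a + ρ) (by simpa [Real.dist_eq, abs_of_pos hρ0])
    rwa [add_sub_cancel_left, sign_pos hρ0, sign_eq_one_iff] at this
  have hneg : F (a - ρ, b) < 0 := by
    have := hsign (y := a - ρ) (by simpa [Real.dist_eq, abs_of_pos hρ0])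
    rwa [sub_sub_cancel_left, sign_neg (neg_neg_of_pos hρ0), sign_eq_neg_one_iff] at this
  have hev : ∀ᶠ y in 𝓝 b, y ∈ Prod.snd '' {z | z ∈ U ∧ F z = 0} := by
    have h1 : ∀ᶠ y in 𝓝 b, 0 < F (a + ρ, y) :=
      (by fun_prop : Continuous fun y => F (a + ρ, y)).continuousAt.eventually_const_lt hpos
    have h2 : ∀ᶠ y in 𝓝 b, F (a - ρ, y) < 0 :=
      (by fun_prop : Continuous fun y => F (a - ρ, y)).continuousAt.eventually_lt_const hneg
    filter_upwards [h1, h2, Metric.ball_mem_nhds b hε] with y hy1 hy2 hy3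
    obtain ⟨x, hx, hx0⟩ := intermediate_value_Icc (by linarith : a - ρ ≤ a + ρ)
      (by fun_prop : Continuous fun x => F (x, y)).continuousOn ⟨hy2.le, hy1.le⟩
    refine ⟨(x, y), ⟨hball ?_, hx0⟩, rfl⟩
    rw [Metric.mem_ball, Prod.dist_eq, max_lt_iff]
    refine ⟨?_, hy3⟩
    rw [Real.dist_eq, abs_lt]
    constructor <;> linarith [hx.1, hx.2]
  exact Set.Infinite.of_image _ (infinite_of_mem_nhds b hev)

theorem infinite_zeros_of_deriv_ne_zero {F : ℝ × ℝ → ℝ} (hF : Continuous F) {U : Set (ℝ × ℝ)}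
    (hU : IsOpen U) {a b : ℝ} (hab : (a, b) ∈ U) (h0 : F (a, b) = 0)
    (hd : deriv (fun t => F (t, b)) a ≠ 0) : {z | z ∈ U ∧ F z = 0}.Infinite := by
  rcases hd.lt_or_gt with hd | hd
  · simpa using infinite_zeros_of_deriv_pos hF.neg hU hab (by simpa using h0)
      (by simpa [deriv.fun_neg] using hd)
  · exact infinite_zeros_of_deriv_pos hF hU hab h0 hd

namespace MvPolynomial

/-- All partial derivatives vanish at an isolated real zero of a polynomial in at least two
variables. -/
theorem eval_pderiv_eq_zero_of_finite_zeros {σ : Type*} [Nontrivial σ] {p : MvPolynomial σ ℝ}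
    {U : Set (σ → ℝ)} (hU : IsOpen U) (hfin : {x | x ∈ U ∧ eval x p = 0}.Finite)
    {x : σ → ℝ} (hx : x ∈ U) (h0 : eval x p = 0) (i : σ) : eval x (pderiv i p) = 0 := by
  classical
  by_contra hd
  obtain ⟨j, hj⟩ := exists_ne i
  let Φ : ℝ × ℝ → σ → ℝ := fun z => Function.update (Function.update x j z.2) i z.1
  have hΦ : Continuous Φ := 
    ((continuous_const (y := x)).update j continuous_snd).update i continuous_fst
  have hΦx : Φ (x i, x j) = x := by simp [Φ]
  have hinj : Function.Injective Φ := fun z w h => by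
    have h1 := congrFun h i
    have h2 := congrFun h j
    simp only [Φ, Function.update_self, Function.update_of_ne hj] at h1 h2
    exact Prod.ext h1 h2
  have hder := (hasDerivAt_eval_update p x i (x i)).deriv
  rw [Function.update_eq_self] at hder
  have hF : Continuous fun z => eval (Φ z) p := (MvPolynomial.continuous_eval p).comp hΦ
  refine infinite_zeros_of_deriv_ne_zero hF (hU.preimage hΦ)
    (a := x i) (b := x j) (by simpa [hΦx] using hx) (by simpa [hΦx] using h0) ?_
    (hfin.preimage hinj.injOn)
  simpa [Φ, hder] using hd

theorem ncard_zeros_le_of_irreducible {p : MvPolynomial (Fin 2) ℝ} (hp : Irreducible p)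
    {U : Set (Fin 2 → ℝ)} (hU : IsOpen U) (hfin : {x | x ∈ U ∧ eval x p = 0}.Finite) :
    {x | x ∈ U ∧ eval x p = 0}.ncard ≤ p.totalDegree ^ 2 := by
  have hdeg : p.totalDegree ≠ 0 := fun h => by
    rw [totalDegree_eq_zero_iff_eq_C] at h
    rw [h] at hp
    have hc : coeff 0 p ≠ 0 := fun hc => hp.ne_zero (by rw [hc, C_0])
    exact hp.not_isUnit ((isUnit_iff_ne_zero.2 hc).map C)
  obtain ⟨i, hi⟩ := exists_pderiv_ne_zero hdeg
  have hlt := totalDegree_pderiv_lt hi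
  have hrel : IsRelPrime p (pderiv i p) := hp.isRelPrime_iff_not_dvd.2 fun ⟨q, hq⟩ => by
    have hq0 : q ≠ 0 := by rintro rfl; exact hi (by simpa using hq)
    rw [hq, totalDegree_mul_of_isDomain hp.ne_zero hq0] at hlt
    omega
  rw [Set.ncard_eq_toFinset_card _ hfin, sq]
  refine (card_le_totalDegree_mul_totalDegree hp.ne_zero hi hrel _ ?_ ?_).trans
    (Nat.mul_le_mul_left _ hlt.le)
  · intro x hx
    exact ((hfin.mem_toFinset).1 hx).2
  · intro x hx
    obtain ⟨hxU, hx0⟩ := (hfin.mem_toFinset).1 hx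
    exact eval_pderiv_eq_zero_of_finite_zeros hU hfin hxU hx0 i

theorem ncard_zeros_le_sq_totalDegree {p : MvPolynomial (Fin 2) ℝ} (hp : p ≠ 0)
    {U : Set (Fin 2 → ℝ)} (hU : IsOpen U) (hfin : {x | x ∈ U ∧ eval x p = 0}.Finite) :
    {x | x ∈ U ∧ eval x p = 0}.ncard ≤ p.totalDegree ^ 2 := by
  induction p using WfDvdMonoid.induction_on_irreducible with
  | zero => exact absurd rfl hp
  | unit u hu =>
    have : {x | x ∈ U ∧ eval x u = 0} = ∅ :=
      Set.eq_empty_of_forall_notMem fun x hx => (hu.map (eval x)).ne_zero hx.2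
    simp [this]
  | mul a q ha hq ih =>
    have hunion : {x | x ∈ U ∧ eval x (q * a) = 0} =
        {x | x ∈ U ∧ eval x q = 0} ∪ {x | x ∈ U ∧ eval x a = 0} := by
      ext x; simp [and_or_left]
    rw [hunion] at hfin ⊢
    have h1 := ncard_zeros_le_of_irreducible hq hU (hfin.subset Set.subset_union_left)
    have h2 := ih ha (hfin.subset Set.subset_union_right)
    have h3 := Set.ncard_union_le {x | x ∈ U ∧ eval x q = 0} {x | x ∈ U ∧ eval x a = 0}
    rw [totalDegree_mul_of_isDomain hq.ne_zero ha, add_sq]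
    refine h3.trans ?_
    linarith [Nat.zero_le (2 * q.totalDegree * a.totalDegree)]

/-- **Real Bézout inequality**: the number of common zeros of two nonzero real polynomials in an
open subset of the plane, if finite, is at most the product of their degrees. -/
theorem ncard_common_zeros_le {f g : MvPolynomial (Fin 2) ℝ} (hf : f ≠ 0) (hg : g ≠ 0)
    {U : Set (Fin 2 → ℝ)} (hU : IsOpen U)
    (hfin : {x | x ∈ U ∧ eval x f = 0 ∧ eval x g = 0}.Finite) :
    {x | x ∈ U ∧ eval x f = 0 ∧ eval x g = 0}.ncard ≤ f.totalDegree * g.totalDegree := by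
  obtain ⟨f', g', h, hrel, rfl, rfl⟩ := UniqueFactorizationMonoid.exists_reduced_factors f hf g
  have hh := left_ne_zero_of_mul hf
  have hf' := right_ne_zero_of_mul hf
  have hg' := right_ne_zero_of_mul hg
  have hunion : {x | x ∈ U ∧ eval x (h * f') = 0 ∧ eval x (h * g') = 0} =
      {x | x ∈ U ∧ eval x h = 0} ∪ {x | x ∈ U ∧ eval x f' = 0 ∧ eval x g' = 0} := by
    ext x
    simp only [Set.mem_ofPred_eq, Set.mem_union, map_mul, mul_eq_zero]
    tauto
  rw [hunion] at hfin ⊢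
  have hfin' := hfin.subset Set.subset_union_right
  have h1 := ncard_zeros_le_sq_totalDegree hh hU (hfin.subset Set.subset_union_left)
  have h2 : {x | x ∈ U ∧ eval x f' = 0 ∧ eval x g' = 0}.ncard ≤
      f'.totalDegree * g'.totalDegree := by
    rw [Set.ncard_eq_toFinset_card _ hfin']
    exact card_le_totalDegree_mul_totalDegree hf' hg' hrel _
      (fun x hx => ((hfin'.mem_toFinset).1 hx).2.1) (fun x hx => ((hfin'.mem_toFinset).1 hx).2.2)
  have h3 := Set.ncard_union_le {x | x ∈ U ∧ eval x h = 0}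
    {x | x ∈ U ∧ eval x f' = 0 ∧ eval x g' = 0}
  rw [totalDegree_mul_of_isDomain hh hf', totalDegree_mul_of_isDomain hh hg']
  nlinarith

end MvPolynomial

/-- **Lemma 8 (real Bézout).** Let `f, g ∈ ℝ[X,Y]` be nonzero of total degrees `δ` and
`d`, and let `𝒰 ⊆ ℝ²` be open.  If the set of solutions in `𝒰` of `f = g = 0` is
finite, then its cardinality is at most `d²/4 + d·δ`. -/
theorem real_bezout_card_le
    (f g : MvPolynomial (Fin 2) ℝ) (hf : f ≠ 0) (hg : g ≠ 0)
    (δ d : ℕ) (hδ : f.totalDegree = δ) (hd : g.totalDegree = d)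
    (U : Set (ℝ × ℝ)) (hU : IsOpen U)
    (hfin : {p : ℝ × ℝ | p ∈ U ∧ eval ![p.1, p.2] f = 0 ∧ eval ![p.1, p.2] g = 0}.Finite) :
    ({p : ℝ × ℝ | p ∈ U ∧ eval ![p.1, p.2] f = 0 ∧
        eval ![p.1, p.2] g = 0}.ncard : ℝ) ≤ (d : ℝ) ^ 2 / 4 + d * δ := by
  subst hδ hd
  let e : (Fin 2 → ℝ) ≃ₜ ℝ × ℝ := Homeomorph.finTwoArrow
  have himage : e '' {x | x ∈ e ⁻¹' U ∧ eval x f = 0 ∧ eval x g = 0} =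
      {p : ℝ × ℝ | p ∈ U ∧ eval ![p.1, p.2] f = 0 ∧ eval ![p.1, p.2] g = 0} := by
    rw [e.image_eq_preimage_symm]
    ext p
    simp [e]
  rw [← himage] at hfin ⊢
  rw [Set.ncard_image_of_injective _ e.injective]
  have h := ncard_common_zeros_le hf hg (hU.preimage e.continuous)
    (hfin.of_finite_image e.injective.injOn)
  have h' : ({x | x ∈ e ⁻¹' U ∧ eval x f = 0 ∧ eval x g = 0}.ncard : ℝ) ≤
      f.totalDegree * g.totalDegree := by exact_mod_cast h
  nlinarith [sq_nonneg (g.totalDegree : ℝ)]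
end
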